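/- arXiv:0812.3188 — 6 statements merged into one kernel-verified Lean document; each statement's English description precedes it below -/
import Mathlib

section
/- Let the stationary setup hold with additionally E[X₀⁴] < ∞. Define G_n = σ(X_k : k ≥ n) for n ≥ 1 and the strong mixing coefficients α_n = sup{ |P(A ∩ B) − P(A)P(B)| : A ∈ F₀, B ∈ G_n }. If there exists ε > 0 such that ∑_{n=1}^∞ α_n^{1/2−ε} < ∞, then condition (MW) holds, i.e. ∑_{n=1}^∞ n^{−3/2} ‖E(S_n | F₀)‖ < ∞. -/
open MeasureTheory

section MixingInequalities

variable {Ω : Type*} {m m' m0 : MeasurableSpace Ω} {P : Measure Ω}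

/-- If every set of `m` gives `f` an integral of size at most `c`, then the conditional expectation
of `f` given `m` has `L¹` norm at most `2 * c`. -/
lemma integral_abs_condExp_le_of_abs_setIntegral_le [IsFiniteMeasure P] (hm : m ≤ m0)
    {f : Ω → ℝ} (hf : Integrable f P) {c : ℝ}
    (h : ∀ B, MeasurableSet[m] B → |∫ ω in B, f ω ∂P| ≤ c) :
    ∫ ω, |(P[f|m]) ω| ∂P ≤ 2 * c := by
  set B : Set Ω := {ω | 0 ≤ (P[f|m]) ω}
  have hBm : MeasurableSet[m] B :=
    (stronglyMeasurable_condExp (m := m) (f := f) (μ := P)).measurable measurableSet_Ici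
  have hint : Integrable (P[f|m]) P := integrable_condExp
  rw [← integral_add_compl (hm _ hBm) hint.abs]
  have h1 : ∫ ω in B, |(P[f|m]) ω| ∂P = ∫ ω in B, f ω ∂P := by
    rw [← setIntegral_condExp hm hf hBm]
    exact setIntegral_congr_fun (hm _ hBm) fun ω hω => abs_of_nonneg hω
  have h2 : ∫ ω in Bᶜ, |(P[f|m]) ω| ∂P = -∫ ω in Bᶜ, f ω ∂P := by
    rw [← setIntegral_condExp hm hf hBm.compl, ← integral_neg]
    refine setIntegral_congr_fun (hm _ hBm.compl) fun ω hω => abs_of_nonpos ?_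
    have hω' : ¬ 0 ≤ (P[f|m]) ω := hω
    exact (not_le.mp hω').le
  rw [h1, h2]
  have h3 := (abs_le.mp (h B hBm)).2
  have h4 := (abs_le.mp (h Bᶜ hBm.compl)).1
  linarith

/-- Covariance inequality between an event and a bounded variable. -/
lemma abs_setIntegral_sub_le_of_mixing [IsProbabilityMeasure P] (hm : m ≤ m0)
    {A : Set Ω} (hA : MeasurableSet A) {a M : ℝ}
    (hmix : ∀ B, MeasurableSet[m] B → |P.real (A ∩ B) - P.real A * P.real B| ≤ a)
    {f : Ω → ℝ} (hf : Measurable[m] f) (hM : ∀ ω, |f ω| ≤ M) :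
    |∫ ω in A, (f ω - ∫ x, f x ∂P) ∂P| ≤ 2 * a * M := by
  have hf0 : Measurable f := hf.mono hm le_rfl
  have hfi : Integrable f P := Integrable.of_bound hf0.aestronglyMeasurable M
    (ae_of_all _ hM)
  set g : Ω → ℝ := fun ω => A.indicator (fun _ => (1 : ℝ)) ω - P.real A with hg
  have hgm : Measurable g := (measurable_const.indicator hA).sub_const _
  have hi1 : Integrable (A.indicator (fun _ => (1 : ℝ))) P :=
    (integrable_const (1 : ℝ)).indicator hA
  have hgi : Integrable g P := hi1.sub (integrable_const _)
  have hgf : Integrable (g * f) P := by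
    exact hgi.mul_bdd (c := M) hf0.aestronglyMeasurable (ae_of_all _ hM)
  have hset : ∀ B, MeasurableSet[m] B → |∫ ω in B, g ω ∂P| ≤ a := by
    intro B hB
    have : ∫ ω in B, g ω ∂P = P.real (A ∩ B) - P.real A * P.real B := by
      rw [integral_sub hi1.integrableOn (integrable_const _), integral_indicator_const _ hA]
      simp [measureReal_restrict_apply hA, mul_comm]
    rw [this]
    exact hmix B hB
  have hL1 := integral_abs_condExp_le_of_abs_setIntegral_le hm hgi hset
  have heq : ∫ ω in A, (f ω - ∫ x, f x ∂P) ∂P = ∫ ω, (P[g|m]) ω * f ω ∂P := by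
    have h1 : ∫ ω, (P[g|m]) ω * f ω ∂P = ∫ ω, (g * f) ω ∂P := by
      rw [← integral_condExp hm (f := g * f)]
      exact integral_congr_ae
        (condExp_mul_of_stronglyMeasurable_right hf.stronglyMeasurable hgf hgi).symm
    have h2 : g * f = fun ω => A.indicator f ω - P.real A * f ω := by
      ext ω
      by_cases hω : ω ∈ A <;> simp [hg, hω, sub_mul]
    rw [h1, h2, integral_sub (hfi.indicator hA) (hfi.const_mul _), integral_indicator hA,
      integral_const_mul, integral_sub hfi.integrableOn (integrable_const _)]
    simp
  have hc : Integrable (P[g|m]) P := integrable_condExp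
  rw [heq]
  calc |∫ ω, (P[g|m]) ω * f ω ∂P| ≤ ∫ ω, |(P[g|m]) ω * f ω| ∂P := abs_integral_le_integral_abs
    _ ≤ ∫ ω, |(P[g|m]) ω| * M ∂P := by
      refine integral_mono (hc.mul_bdd (c := M) hf0.aestronglyMeasurable (ae_of_all _ hM)).abs
        (hc.abs.mul_const M) fun ω => ?_
      simp only [abs_mul]
      exact mul_le_mul_of_nonneg_left (hM ω) (abs_nonneg _)
    _ = (∫ ω, |(P[g|m]) ω| ∂P) * M := integral_mul_const _ _
    _ ≤ 2 * a * M := by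
      obtain ⟨ω⟩ : Nonempty Ω := P.nonempty_of_neZero
      exact mul_le_mul_of_nonneg_right hL1 ((abs_nonneg _).trans (hM ω))

/-- The `L²` seminorm as the square root of an integral. -/
lemma sqrt_integral_sq_eq_toReal_eLpNorm {f : Ω → ℝ} (hf : MemLp f 2 P) :
    √(∫ ω, f ω ^ 2 ∂P) = (eLpNorm f 2 P).toReal := by
  rw [hf.eLpNorm_eq_integral_rpow_norm two_ne_zero ENNReal.ofNat_ne_top,
    ENNReal.toReal_ofReal (by positivity), Real.sqrt_eq_rpow]
  simp

/-- Jensen's inequality for the square of a conditional expectation, in integrated form. -/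
lemma integral_condExp_sq_le [IsFiniteMeasure P] {f : Ω → ℝ} (hf : MemLp f 2 P) :
    ∫ ω, (P[f|m]) ω ^ 2 ∂P ≤ ∫ ω, f ω ^ 2 ∂P := by
  rw [← Real.sqrt_le_sqrt_iff (integral_nonneg fun _ => sq_nonneg _),
    sqrt_integral_sq_eq_toReal_eLpNorm hf,
    sqrt_integral_sq_eq_toReal_eLpNorm (hf.condExp one_le_two)]
  exact ENNReal.toReal_mono hf.eLpNorm_ne_top (eLpNorm_condExp_le_eLpNorm f one_le_two)

/-- `L²` bound for the conditional expectation of a bounded variable, centred at its mean, given a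
`σ`-algebra with which it is mixing. -/
lemma integral_condExp_sub_integral_sq_le [IsProbabilityMeasure P] (hm : m ≤ m0) (hm' : m' ≤ m0)
    {a M : ℝ} (hmix : ∀ A B, MeasurableSet[m] A → MeasurableSet[m'] B →
      |P.real (A ∩ B) - P.real A * P.real B| ≤ a)
    {f : Ω → ℝ} (hf : Measurable[m'] f) (hM : ∀ ω, |f ω| ≤ M) :
    ∫ ω, (P[fun ω => f ω - ∫ x, f x ∂P|m]) ω ^ 2 ∂P ≤ 8 * a * M ^ 2 := by
  obtain ⟨ω₀⟩ : Nonempty Ω := P.nonempty_of_neZero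
  have hM0 : 0 ≤ M := (abs_nonneg _).trans (hM ω₀)
  have hf0 : Measurable f := hf.mono hm' le_rfl
  set u : Ω → ℝ := fun ω => f ω - ∫ x, f x ∂P with hu
  have hc : |∫ x, f x ∂P| ≤ M := by
    have := norm_integral_le_of_norm_le_const (μ := P) (f := f) (ae_of_all _ hM)
    simpa using this
  have hub : ∀ ω, |u ω| ≤ 2 * M := fun ω => by
    have h1 := abs_le.mp (hM ω)
    have h2 := abs_le.mp hc
    simp only [hu, abs_le]
    constructor <;> linarith
  have hui : Integrable u P :=
    Integrable.of_bound (hf0.sub_const _).aestronglyMeasurable (2 * M) (ae_of_all _ hub)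
  have hL1 := integral_abs_condExp_le_of_abs_setIntegral_le hm hui (c := 2 * a * M)
    fun A hA => abs_setIntegral_sub_le_of_mixing hm' (hm _ hA) (fun B hB => hmix A B hA hB) hf hM
  have hbdd : ∀ᵐ ω ∂P, |(P[u|m]) ω| ≤ 2 * M :=
    ae_bdd_abs_condExp_of_ae_bdd_abs (ae_of_all _ hub)
  have hci : Integrable (P[u|m]) P := integrable_condExp
  have hle : ∫ ω, (P[u|m]) ω ^ 2 ∂P ≤ ∫ ω, 2 * M * |(P[u|m]) ω| ∂P := by
    refine integral_mono_of_nonneg (ae_of_all _ fun _ => sq_nonneg _) (hci.abs.const_mul _) ?_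
    filter_upwards [hbdd] with ω hω
    rw [← sq_abs, sq]
    exact mul_le_mul_of_nonneg_right hω (abs_nonneg _)
  rw [integral_const_mul] at hle
  nlinarith [mul_le_mul_of_nonneg_left hL1 hM0]

/-- Bound, by truncation at level `M`, for the conditional expectation of a centred variable with a
finite fourth moment given a `σ`-algebra with which it is mixing. -/
lemma integral_condExp_sq_le_of_mixing [IsProbabilityMeasure P] (hm : m ≤ m0) (hm' : m' ≤ m0)
    {a M : ℝ} (hM : 0 < M)
    (hmix : ∀ A B, MeasurableSet[m] A → MeasurableSet[m'] B →
      |P.real (A ∩ B) - P.real A * P.real B| ≤ a)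
    {f : Ω → ℝ} (hf : Measurable[m'] f) (hf2 : MemLp f 2 P)
    (hf4 : Integrable (fun ω => f ω ^ 4) P) (hmean : ∫ ω, f ω ∂P = 0) :
    ∫ ω, (P[f|m]) ω ^ 2 ∂P ≤ 16 * a * M ^ 2 + 2 * (∫ ω, f ω ^ 4 ∂P) / M ^ 2 := by
  set s : Set Ω := {ω | |f ω| ≤ M}
  have hsm' : MeasurableSet[m'] s :=
    hf (measurableSet_le measurable_id.abs measurable_const : MeasurableSet {x : ℝ | |x| ≤ M})
  have hsm : MeasurableSet s := hm' _ hsm'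
  have hfi : Integrable f P := hf2.integrable one_le_two
  set f₁ : Ω → ℝ := s.indicator f with hf₁
  set f₂ : Ω → ℝ := sᶜ.indicator f with hf₂
  have hadd : ∀ ω, f₁ ω + f₂ ω = f ω := fun ω =>
    congrFun (Set.indicator_self_add_compl s f) ω
  have hf₁i : Integrable f₁ P := hfi.indicator hsm
  have hf₂L : MemLp f₂ 2 P := hf2.indicator hsm.compl
  have hf₂i : Integrable f₂ P := hf₂L.integrable one_le_two
  set c : ℝ := ∫ ω, f₁ ω ∂P
  have hc₂ : ∫ ω, f₂ ω ∂P = -c := by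
    have h : ∫ ω, (f₁ ω + f₂ ω) ∂P = 0 := by simpa only [hadd] using hmean
    rw [integral_add hf₁i hf₂i] at h
    linarith
  set u : Ω → ℝ := fun ω => f₁ ω - c with hu
  set v : Ω → ℝ := fun ω => f₂ ω + c with hv
  have hui : Integrable u P := hf₁i.sub (integrable_const _)
  have hvL : MemLp v 2 P := hf₂L.add (memLp_const c)
  have hvi : Integrable v P := hvL.integrable one_le_two
  have huL : MemLp u 2 P := (hf2.indicator hsm).sub (memLp_const c)
  have hfuv : f = u + v := by
    ext ω
    simp only [hu, hv, Pi.add_apply, ← hadd ω]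
    ring
  have hU : ∫ ω, (P[u|m]) ω ^ 2 ∂P ≤ 8 * a * M ^ 2 := by
    refine integral_condExp_sub_integral_sq_le hm hm' hmix (hf.indicator hsm') fun ω => ?_
    by_cases hω : ω ∈ s
    · rw [hf₁, Set.indicator_of_mem hω]
      exact hω
    · rw [hf₁, Set.indicator_of_notMem hω, abs_zero]
      exact hM.le
  have hV : ∫ ω, (P[v|m]) ω ^ 2 ∂P ≤ (∫ ω, f ω ^ 4 ∂P) / M ^ 2 := by
    refine (integral_condExp_sq_le hvL).trans ?_
    have h1 : ∫ ω, v ω ^ 2 ∂P = ∫ ω, f₂ ω ^ 2 ∂P - c ^ 2 := by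
      have : ∀ ω, v ω ^ 2 = f₂ ω ^ 2 + (2 * c * f₂ ω + c ^ 2) := fun ω => by
        simp only [hv]
        ring
      have hlin : Integrable (fun ω => 2 * c * f₂ ω + c ^ 2) P :=
        (hf₂i.const_mul _).add (integrable_const _)
      simp only [this]
      rw [integral_add hf₂L.integrable_sq hlin,
        integral_add (hf₂i.const_mul _) (integrable_const _), integral_const_mul, hc₂]
      simp
      ring
    have h2 : ∫ ω, f₂ ω ^ 2 ∂P ≤ (∫ ω, f ω ^ 4 ∂P) / M ^ 2 := by
      rw [← integral_div]
      refine integral_mono hf₂L.integrable_sq (hf4.div_const _) fun ω => ?_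
      change f₂ ω ^ 2 ≤ f ω ^ 4 / M ^ 2
      by_cases hω : ω ∈ s
      · simp only [hf₂, Set.indicator, Set.mem_compl_iff, hω, not_true_eq_false, if_false]
        rw [zero_pow two_ne_zero]
        positivity
      · have hlt : M ≤ |f ω| := (not_le.mp (show ¬ |f ω| ≤ M from hω)).le
        have hsq : M ^ 2 ≤ f ω ^ 2 := by
          rw [← sq_abs (f ω)]
          exact pow_le_pow_left₀ hM.le hlt 2
        simp only [hf₂, Set.indicator, Set.mem_compl_iff, hω, not_false_eq_true, if_true]
        rw [le_div_iff₀ (by positivity)]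
        nlinarith [sq_nonneg (f ω)]
    nlinarith [sq_nonneg c]
  have hae : P[f|m] =ᵐ[P] P[u|m] + P[v|m] := by
    rw [hfuv]
    exact condExp_add hui hvi m
  have hu2 := (huL.condExp (m := m) one_le_two).integrable_sq
  have hv2 := (hvL.condExp (m := m) one_le_two).integrable_sq
  have hsum : ∫ ω, (P[f|m]) ω ^ 2 ∂P ≤
      ∫ ω, (2 * (P[u|m]) ω ^ 2 + 2 * (P[v|m]) ω ^ 2) ∂P := by
    refine integral_mono_of_nonneg (ae_of_all _ fun _ => sq_nonneg _)
      ((hu2.const_mul 2).add (hv2.const_mul 2)) ?_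
    filter_upwards [hae] with ω hω
    rw [hω, Pi.add_apply]
    nlinarith [sq_nonneg ((P[u|m]) ω - (P[v|m]) ω)]
  rw [integral_add (hu2.const_mul 2) (hv2.const_mul 2), integral_const_mul,
    integral_const_mul] at hsum
  rw [mul_div_assoc]
  linarith

end MixingInequalities

section RealSeries

/-- A nonnegative antitone sequence bounded by one with a summable power below the exponent `1/2`
decays polynomially with exponent larger than two. -/
lemma exists_le_rpow_of_summable_rpow {α : ℕ → ℝ} (h0 : ∀ n, 0 ≤ α n) (h1 : ∀ n, α n ≤ 1)
    (hanti : Antitone α) {s : ℝ} (hs : s < 1 / 2) (hsum : Summable fun n => α n ^ s) :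
    ∃ γ C : ℝ, 1 / 2 < γ ∧ γ ≤ 1 ∧ ∀ n : ℕ, α n ≤ C * ((n : ℝ) + 1) ^ (-(4 * γ)) := by
  obtain ⟨t, ht, ht4, ht2⟩ : ∃ t, s ≤ t ∧ 1 / 4 ≤ t ∧ t < 1 / 2 :=
    ⟨max s (1 / 4), le_max_left _ _, le_max_right _ _, max_lt hs (by norm_num)⟩
  have ht0 : 0 < t := by linarith
  have hsumt : Summable fun n => α n ^ t := by
    refine hsum.of_nonneg_of_le (fun n => Real.rpow_nonneg (h0 n) _) fun n => ?_
    rcases (h0 n).eq_or_lt with h | h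
    · rw [← h, Real.zero_rpow ht0.ne']
      exact Real.rpow_nonneg le_rfl _
    · exact Real.rpow_le_rpow_of_exponent_ge h (h1 n) ht
  set K : ℝ := ∑' n, α n ^ t
  have hK0 : 0 ≤ K := tsum_nonneg fun n => Real.rpow_nonneg (h0 n) _
  refine ⟨1 / (4 * t), K ^ (1 / t), ?_, ?_, fun n => ?_⟩
  · rw [lt_div_iff₀ (by positivity)]
    linarith
  · rw [div_le_one (by positivity)]
    linarith
  · have hn : (0 : ℝ) < (n : ℝ) + 1 := by positivity
    have hle : ((n : ℝ) + 1) * α n ^ t ≤ K := by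
      refine le_trans ?_ (hsumt.sum_le_tsum (Finset.range (n + 1))
        fun i _ => Real.rpow_nonneg (h0 i) _)
      have := Finset.card_nsmul_le_sum (Finset.range (n + 1)) (fun i => α i ^ t) (α n ^ t)
        fun i hi => Real.rpow_le_rpow (h0 n)
          (hanti (Nat.lt_succ_iff.mp (Finset.mem_range.mp hi))) ht0.le
      simpa using this
    have hle' : α n ^ t ≤ K * ((n : ℝ) + 1)⁻¹ := by
      rw [← div_eq_mul_inv, le_div_iff₀ hn, mul_comm]
      exact hle
    have hpow := Real.rpow_le_rpow (Real.rpow_nonneg (h0 n) _) hle' (z := 1 / t) (by positivity)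
    rw [← Real.rpow_mul (h0 n), mul_one_div_cancel ht0.ne', Real.rpow_one,
      Real.mul_rpow hK0 (by positivity), Real.inv_rpow hn.le, ← Real.rpow_neg hn.le] at hpow
    convert hpow using 3
    field_simp

/-- If `b n = O(n ^ (-γ))` with `γ > 1/2`, then the partial sums of `b` are summable against
`n ^ (-3/2)`. -/
lemma summable_rpow_mul_sum_range {b : ℕ → ℝ} (hb0 : ∀ n, 0 ≤ b n) {γ C : ℝ} (hγ : 1 / 2 < γ)
    (hγ1 : γ ≤ 1) (hb : ∀ n : ℕ, b n ≤ C * ((n : ℝ) + 1) ^ (-γ)) :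
    Summable fun n : ℕ => ((n : ℝ) + 1) ^ (-(3 : ℝ) / 2) * ∑ i ∈ Finset.range (n + 1), b i := by
  set η : ℝ := (γ - 1 / 2) / 2 with hη
  have hC : 0 ≤ C := by simpa using (hb0 0).trans (hb 0)
  have hsum : ∀ {p : ℝ}, p < -1 → Summable fun n : ℕ => ((n : ℝ) + 1) ^ p := fun {p} hp => by
    have := (summable_nat_add_iff 1).mpr (Real.summable_nat_rpow.mpr hp)
    simpa using this
  have hs := hsum (p := -(1 + η)) (by linarith)
  set K : ℝ := ∑' n : ℕ, ((n : ℝ) + 1) ^ (-(1 + η))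
  have hpart : ∀ n : ℕ, ∑ i ∈ Finset.range (n + 1), b i ≤
      C * ((n : ℝ) + 1) ^ (1 + η - γ) * K := fun n => by
    calc ∑ i ∈ Finset.range (n + 1), b i
        ≤ ∑ i ∈ Finset.range (n + 1),
            C * ((n : ℝ) + 1) ^ (1 + η - γ) * ((i : ℝ) + 1) ^ (-(1 + η)) := by
          refine Finset.sum_le_sum fun i hi => (hb i).trans ?_
          have hi' : (i : ℝ) ≤ n := by
            exact_mod_cast Nat.lt_succ_iff.mp (Finset.mem_range.mp hi)
          have hi0 : (0 : ℝ) < (i : ℝ) + 1 := by positivity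
          rw [mul_assoc, show -γ = (1 + η - γ) + -(1 + η) by ring, Real.rpow_add hi0]
          gcongr
          linarith
      _ ≤ C * ((n : ℝ) + 1) ^ (1 + η - γ) * K := by
          rw [← Finset.mul_sum]
          refine mul_le_mul_of_nonneg_left ?_ (by positivity)
          exact hs.sum_le_tsum _ fun i _ => by positivity
  refine ((hsum (p := -(3 : ℝ) / 2 + (1 + η - γ)) (by linarith)).mul_left (C * K)).of_nonneg_of_le
    (fun n => mul_nonneg (by positivity) (Finset.sum_nonneg fun i _ => hb0 i)) fun n => ?_
  have hn : (0 : ℝ) < (n : ℝ) + 1 := by positivity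
  rw [Real.rpow_add hn]
  refine (mul_le_mul_of_nonneg_left (hpart n) (by positivity)).trans_eq ?_
  ring

end RealSeries

section StationarySequence

variable {Ω : Type*} {mΩ : MeasurableSpace Ω} {P : Measure Ω} {T : Ω ≃ᵐ Ω} {X : ℤ → Ω → ℝ}

lemma measurable_of_shift (hX0 : Measurable (X 0)) (hshift : ∀ k : ℤ, ∀ ω, X (k + 1) ω = X k (T ω))
    (k : ℤ) : Measurable (X k) := by
  induction k using Int.induction_on with
  | zero => exact hX0
  | succ k ih =>
    rw [show X (k + 1) = X k ∘ T from funext (hshift k)]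
    exact ih.comp T.measurable
  | pred k ih =>
    have h : X (-k - 1) = X (-k) ∘ T.symm := by
      ext ω
      have := hshift (-k - 1) (T.symm ω)
      simpa using this.symm
    rw [h]
    exact ih.comp T.symm.measurable

lemma exists_measurePreserving_eq_comp (hT : MeasurePreserving T P P)
    (hshift : ∀ k : ℤ, ∀ ω, X (k + 1) ω = X k (T ω)) (n : ℕ) :
    ∃ τ : Ω ≃ᵐ Ω, MeasurePreserving τ P P ∧ ∀ ω, X n ω = X 0 (τ ω) := by
  induction n with
  | zero => exact ⟨MeasurableEquiv.refl Ω, MeasurePreserving.id P, fun _ => rfl⟩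
  | succ n ih =>
    obtain ⟨τ, hτ, h⟩ := ih
    refine ⟨T.trans τ, hτ.comp hT, fun ω => ?_⟩
    rw [Nat.cast_succ, hshift, h]
    rfl

lemma memLp_of_shift (hT : MeasurePreserving T P P)
    (hshift : ∀ k : ℤ, ∀ ω, X (k + 1) ω = X k (T ω)) {p : ENNReal} (h0 : MemLp (X 0) p P) (n : ℕ) :
    MemLp (X n) p P := by
  obtain ⟨τ, hτ, h⟩ := exists_measurePreserving_eq_comp hT hshift n
  rw [show X n = X 0 ∘ τ from funext h]
  exact h0.comp_measurePreserving hτ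

lemma integrable_comp_of_shift (hT : MeasurePreserving T P P)
    (hshift : ∀ k : ℤ, ∀ ω, X (k + 1) ω = X k (T ω)) {φ : ℝ → ℝ}
    (h0 : Integrable (fun ω => φ (X 0 ω)) P) (n : ℕ) : Integrable (fun ω => φ (X n ω)) P := by
  obtain ⟨τ, hτ, h⟩ := exists_measurePreserving_eq_comp hT hshift n
  simp only [h]
  exact hτ.integrable_comp_of_integrable h0

lemma integral_comp_of_shift (hT : MeasurePreserving T P P)
    (hshift : ∀ k : ℤ, ∀ ω, X (k + 1) ω = X k (T ω)) (φ : ℝ → ℝ) (n : ℕ) :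
    ∫ ω, φ (X n ω) ∂P = ∫ ω, φ (X 0 ω) ∂P := by
  obtain ⟨τ, hτ, h⟩ := exists_measurePreserving_eq_comp hT hshift n
  simp only [h]
  exact hτ.integral_comp τ.measurableEmbedding fun ω => φ (X 0 ω)

end StationarySequence

/-- Under the stationary setup with `E[X₀⁴] < ∞`, if the strong mixing
coefficients satisfy `∑ αₙ^{1/2-ε} < ∞` for some `ε > 0`, then condition (MW) holds:
`∑ n^{-3/2} ‖E(Sₙ | F₀)‖ < ∞`. -/
theorem mixing_implies_MW
    {Ω : Type*} [MeasurableSpace Ω] (P : Measure Ω) [IsProbabilityMeasure P]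
    (T : Ω ≃ᵐ Ω) (hT : MeasurePreserving T P P)
    (X : ℤ → Ω → ℝ) (hX0meas : Measurable (X 0))
    (hshift : ∀ k : ℤ, ∀ ω, X (k + 1) ω = X k (T ω))
    (hX2 : Integrable (fun ω => (X 0 ω) ^ 2) P)
    (hX4 : Integrable (fun ω => (X 0 ω) ^ 4) P)
    (hmean : ∫ ω, X 0 ω ∂P = 0)
    (S : ℕ → Ω → ℝ)
    (hS : ∀ n, S n = fun ω => ∑ i ∈ Finset.range n, X (i + 1) ω)
    (F0 : MeasurableSpace Ω)
    (hF0 : F0 = ⨆ k ∈ Set.Iic (0 : ℤ), MeasurableSpace.comap (X k) (borel ℝ))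
    (G : ℕ → MeasurableSpace Ω)
    (hG : ∀ n, G n = ⨆ k ∈ Set.Ici (n : ℤ), MeasurableSpace.comap (X k) (borel ℝ))
    (α : ℕ → ℝ)
    (hα : ∀ n, α n = sSup {x : ℝ | ∃ A B : Set Ω, MeasurableSet[F0] A ∧
        MeasurableSet[G n] B ∧
        x = |(P (A ∩ B)).toReal - (P A).toReal * (P B).toReal|})
    (hmix : ∃ ε : ℝ, 0 < ε ∧
        Summable (fun n : ℕ => (α (n + 1)) ^ ((1 : ℝ) / 2 - ε))) :
    Summable (fun n : ℕ => ((n : ℝ) + 1) ^ (-(3 : ℝ) / 2) *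
      Real.sqrt (∫ ω, ((P[S (n + 1)|F0]) ω) ^ 2 ∂P)) := by
  rename_i mΩ _
  obtain ⟨ε, hε, hsum⟩ := hmix
  have hXm := measurable_of_shift hX0meas hshift
  have hcomap : ∀ k, MeasurableSpace.comap (X k) (borel ℝ) ≤ mΩ := fun k => by
    rw [← BorelSpace.measurable_eq (α := ℝ)]
    exact (hXm k).comap_le
  have hF0le : F0 ≤ mΩ := by
    rw [hF0]
    exact iSup₂_le fun k _ => hcomap k
  have hGle : ∀ n, G n ≤ mΩ := fun n => by
    rw [hG]
    exact iSup₂_le fun k _ => hcomap k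
  have hGanti : Antitone G := fun i j hij => by
    rw [hG, hG]
    exact biSup_mono fun k hk => Set.mem_Ici.mpr
      ((Int.ofNat_le.mpr hij).trans (Set.mem_Ici.mp hk))
  have hXG : ∀ n : ℕ, Measurable[G n] (X n) := fun n => by
    rw [measurable_iff_comap_le, hG, BorelSpace.measurable_eq (α := ℝ)]
    exact le_iSup₂_of_le (n : ℤ) (Set.mem_Ici.mpr le_rfl) le_rfl
  set D : ℕ → Set ℝ := fun n => {x : ℝ | ∃ A B : Set Ω, MeasurableSet[F0] A ∧
        MeasurableSet[G n] B ∧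
        x = |(P (A ∩ B)).toReal - (P A).toReal * (P B).toReal|}
  have hD1 : ∀ n, ∀ x ∈ D n, x ≤ 1 := by
    rintro n x ⟨A, B, -, -, rfl⟩
    change |P.real (A ∩ B) - P.real A * P.real B| ≤ 1
    have h1 : P.real (A ∩ B) ≤ 1 := measureReal_le_one
    have h2 : P.real A * P.real B ≤ 1 :=
      mul_le_one₀ measureReal_le_one measureReal_nonneg measureReal_le_one
    have h3 : 0 ≤ P.real (A ∩ B) := measureReal_nonneg
    have h4 : 0 ≤ P.real A * P.real B := mul_nonneg measureReal_nonneg measureReal_nonneg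
    rw [abs_le]
    constructor <;> linarith
  have hDbdd : ∀ n, BddAbove (D n) := fun n => ⟨1, hD1 n⟩
  have hDne : ∀ n, (D n).Nonempty := fun n =>
    ⟨_, ∅, ∅, @MeasurableSet.empty _ F0, @MeasurableSet.empty _ (G n), rfl⟩
  have hα0 : ∀ n, 0 ≤ α n := fun n => by
    rw [hα]
    refine Real.sSup_nonneg ?_
    rintro x ⟨A, B, -, -, rfl⟩
    exact abs_nonneg _
  have hα1 : ∀ n, α n ≤ 1 := fun n => by
    rw [hα]
    exact csSup_le (hDne n) (hD1 n)
  have hαanti : Antitone α := fun i j hij => by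
    rw [hα, hα]
    refine csSup_le_csSup (hDbdd i) (hDne j) ?_
    rintro x ⟨A, B, hA, hB, rfl⟩
    exact ⟨A, B, hA, hGanti hij _ hB, rfl⟩
  have hαle : ∀ n A B, MeasurableSet[F0] A → MeasurableSet[G n] B →
      |P.real (A ∩ B) - P.real A * P.real B| ≤ α n := fun n A B hA hB => by
    rw [hα]
    exact le_csSup (hDbdd n) ⟨A, B, hA, hB, rfl⟩
  obtain ⟨γ, C, hγ, hγ1, hdecay⟩ := exists_le_rpow_of_summable_rpow
    (α := fun n => α (n + 1)) (fun n => hα0 _) (fun n => hα1 _)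
    (fun i j hij => hαanti (Nat.succ_le_succ hij)) (by linarith) hsum
  set K : ℝ := ∫ ω, X 0 ω ^ 4 ∂P
  have hX0L : MemLp (X 0) 2 P := (memLp_two_iff_integrable_sq hX0meas.aestronglyMeasurable).mpr hX2
  have hXL := memLp_of_shift hT hshift hX0L
  have hbound : ∀ n : ℕ, ∫ ω, (P[X ((n : ℤ) + 1)|F0]) ω ^ 2 ∂P ≤
      (16 * C + 2 * K) * (((n : ℝ) + 1) ^ (-γ)) ^ 2 := fun n => by
    have hn : (0 : ℝ) < (n : ℝ) + 1 := by positivity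
    have hmain := integral_condExp_sq_le_of_mixing hF0le (hGle (n + 1))
      (Real.rpow_pos_of_pos hn γ) (hαle (n + 1)) (hXG (n + 1)) (hXL (n + 1))
      (integrable_comp_of_shift hT hshift (φ := fun x => x ^ 4) hX4 (n + 1))
      ((integral_comp_of_shift hT hshift (fun x => x) (n + 1)).trans hmean)
    rw [integral_comp_of_shift hT hshift (fun x => x ^ 4) (n + 1), Nat.cast_succ] at hmain
    refine hmain.trans ?_
    have hpos : 0 < ((n : ℝ) + 1) ^ γ := Real.rpow_pos_of_pos hn γ
    have hinv : ((n : ℝ) + 1) ^ (-(4 * γ)) = ((((n : ℝ) + 1) ^ γ) ^ 4)⁻¹ := by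
      rw [Real.rpow_neg hn.le, mul_comm, Real.rpow_mul hn.le]
      norm_cast
    have hd := hdecay n
    rw [hinv] at hd
    rw [Real.rpow_neg hn.le]
    set y := ((n : ℝ) + 1) ^ γ
    calc 16 * α (n + 1) * y ^ 2 + 2 * K / y ^ 2
        ≤ 16 * (C * (y ^ 4)⁻¹) * y ^ 2 + 2 * K / y ^ 2 := by gcongr
      _ = (16 * C + 2 * K) * y⁻¹ ^ 2 := by
        field_simp
  have hcL : ∀ n : ℕ, MemLp (P[X ((n : ℤ) + 1)|F0]) 2 P := fun n => by
    have := hXL (n + 1)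
    rw [Nat.cast_succ] at this
    exact this.condExp one_le_two
  have hsummable := summable_rpow_mul_sum_range
    (b := fun n : ℕ => √(∫ ω, (P[X ((n : ℤ) + 1)|F0]) ω ^ 2 ∂P)) (C := √(16 * C + 2 * K))
    (fun n => Real.sqrt_nonneg _) hγ hγ1 fun n => by
      refine (Real.sqrt_le_sqrt (hbound n)).trans_eq ?_
      rw [Real.sqrt_mul' _ (sq_nonneg _), Real.sqrt_sq (by positivity)]
  refine hsummable.of_nonneg_of_le (fun n => by positivity) fun n => ?_
  refine mul_le_mul_of_nonneg_left ?_ (by positivity)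
  have hSsum : S (n + 1) = ∑ i ∈ Finset.range (n + 1), X ((i : ℤ) + 1) := by
    rw [hS]
    ext ω
    rw [Finset.sum_apply]
  have hae : P[S (n + 1)|F0] =ᵐ[P] ∑ i ∈ Finset.range (n + 1), P[X ((i : ℤ) + 1)|F0] := by
    rw [hSsum]
    refine condExp_finsetSum (fun i _ => ?_) F0
    have := (hXL (i + 1)).integrable one_le_two
    rwa [Nat.cast_succ] at this
  have hLsum := memLp_finsetSum' (Finset.range (n + 1)) fun i _ => hcL i
  rw [sqrt_integral_sq_eq_toReal_eLpNorm ((memLp_congr_ae hae).mpr hLsum), eLpNorm_congr_ae hae]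
  simp only [fun i => sqrt_integral_sq_eq_toReal_eLpNorm (hcL i)]
  rw [← ENNReal.toReal_sum fun i _ => (hcL i).eLpNorm_ne_top]
  exact ENNReal.toReal_mono (ENNReal.sum_ne_top.mpr fun i _ => (hcL i).eLpNorm_ne_top)
    (eLpNorm_sum_le (fun i _ => (hcL i).aestronglyMeasurable) one_le_two)
end

section
/- Let (X, d) be a complete separable metric space, (Ω, A, P) a probability space, Z : Ω → X a Borel measurable random element, and A₁ ⊆ A₂ ⊆ A sub-σ-algebras. Let μ₁ and μ₂ be regular conditional distributions for Z given A₁ and A₂ respectively, and let μ be any Borel probability measure on X. Then ρ(μ, μ₁(ω)) ≤ E[ ρ(μ, μ₂(·)) | A₁ ](ω) for P-almost every ω; in particular, E[ρ(μ, μ₁(·))] ≤ E[ρ(μ, μ₂(·))]. -/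
open MeasureTheory

/-- `g` has bounded-Lipschitz norm at most one:
`sup_x |g(x)| + sup_{x≠y} |g(x)-g(y)|/d(x,y) ≤ 1`. -/
def BLNormLEOne {X : Type*} [MetricSpace X] (g : X → ℝ) : Prop :=
  ∃ c₁ c₂ : ℝ, 0 ≤ c₁ ∧ 0 ≤ c₂ ∧ c₁ + c₂ ≤ 1 ∧
    (∀ x, |g x| ≤ c₁) ∧ (∀ x y, |g x - g y| ≤ c₂ * dist x y)

/-- The bounded-Lipschitz metric on Borel probability measures on a metric space. -/
noncomputable def blDist {X : Type*} [MetricSpace X] [MeasurableSpace X]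
    (μ ν : Measure X) : ℝ :=
  sSup {r : ℝ | ∃ g : X → ℝ, BLNormLEOne g ∧ r = |(∫ x, g x ∂μ) - ∫ x, g x ∂ν|}

/-- `κ` is a regular conditional distribution for `Z : Ω → X` given the sub-σ-algebra `A₀`. -/
def IsRCD {Ω X : Type*} {mΩ : MeasurableSpace Ω} [MetricSpace X] [MeasurableSpace X]
    (P : Measure Ω) (A₀ : MeasurableSpace Ω) (Z : Ω → X) (κ : Ω → Measure X) : Prop :=
  (∀ ω, IsProbabilityMeasure (κ ω)) ∧
  (∀ B : Set X, MeasurableSet B → Measurable[A₀] (fun ω => κ ω B)) ∧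
  (∀ A : Set Ω, MeasurableSet[A₀] A → ∀ B : Set X, MeasurableSet B →
    ∫ ω in A, (κ ω B).toReal ∂P = (P (A ∩ Z ⁻¹' B)).toReal)

open Filter Topology ProbabilityTheory

namespace BLNormLEOne

variable {X : Type*} [MetricSpace X] {g : X → ℝ}

lemma abs_le_one (hg : BLNormLEOne g) (x : X) : |g x| ≤ 1 := by
  obtain ⟨c₁, c₂, h₁, h₂, h, hb, -⟩ := hg
  linarith [hb x]

lemma abs_sub_le_dist (hg : BLNormLEOne g) (x y : X) : |g x - g y| ≤ dist x y := by
  obtain ⟨c₁, c₂, h₁, h₂, h, -, hl⟩ := hg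
  exact (hl x y).trans (mul_le_of_le_one_left dist_nonneg (by linarith))

lemma continuous (hg : BLNormLEOne g) : Continuous g :=
  (LipschitzWith.of_dist_le_mul (K := 1) fun x y => by
    simpa [Real.dist_eq] using hg.abs_sub_le_dist x y).continuous

lemma zero : BLNormLEOne (fun _ : X => (0 : ℝ)) :=
  ⟨0, 0, le_rfl, le_rfl, by norm_num, by simp, by simp⟩

lemma integrable [MeasurableSpace X] [BorelSpace X] (hg : BLNormLEOne g) (ν : Measure X)
    [IsFiniteMeasure ν] : Integrable g ν :=
  .of_bound hg.continuous.measurable.aestronglyMeasurable 1 (ae_of_all _ hg.abs_le_one)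

lemma abs_integral_le_one [MeasurableSpace X] (hg : BLNormLEOne g) (ν : Measure X)
    [IsProbabilityMeasure ν] : |∫ x, g x ∂ν| ≤ 1 := by
  simpa using norm_integral_le_of_norm_le_const (f := g) (μ := ν) (ae_of_all _ hg.abs_le_one)

lemma abs_integral_sub_le_two [MeasurableSpace X] (hg : BLNormLEOne g) (μ ν : Measure X)
    [IsProbabilityMeasure μ] [IsProbabilityMeasure ν] :
    |(∫ x, g x ∂μ) - ∫ x, g x ∂ν| ≤ 2 := by
  linarith [abs_sub (∫ x, g x ∂μ) (∫ x, g x ∂ν), hg.abs_integral_le_one μ,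
    hg.abs_integral_le_one ν]

/-- On a dense set, pointwise convergence of functions of bounded-Lipschitz norm at most one
forces pointwise convergence everywhere. -/
lemma tendsto_of_denseRange {ι : Type*} {D : ι → X} (hD : DenseRange D) {u : ℕ → X → ℝ}
    (hu : ∀ k, BLNormLEOne (u k)) (hg : BLNormLEOne g)
    (h : ∀ i, Tendsto (fun k => u k (D i)) atTop (𝓝 (g (D i)))) (x : X) :
    Tendsto (fun k => u k x) atTop (𝓝 (g x)) := by
  rw [Metric.tendsto_atTop]
  intro ε hε
  obtain ⟨i, hi⟩ := hD.exists_dist_lt x (show 0 < ε / 3 by positivity)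
  obtain ⟨N, hN⟩ := Metric.tendsto_atTop.1 (h i) (ε / 3) (by positivity)
  refine ⟨N, fun k hk => ?_⟩
  have h₁ : dist (u k x) (u k (D i)) ≤ dist x (D i) := (hu k).abs_sub_le_dist _ _
  have h₂ : dist (g x) (g (D i)) ≤ dist x (D i) := hg.abs_sub_le_dist _ _
  have h₃ := hN k hk
  have h₄ := dist_triangle4 (u k x) (u k (D i)) (g (D i)) (g x)
  rw [dist_comm (g (D i))] at h₄
  linarith

variable (X) in
/-- The functions of bounded-Lipschitz norm at most one on a separable metric space have a
countable subset which is sequentially dense for pointwise convergence. -/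
lemma exists_seq_pointwise_dense [TopologicalSpace.SeparableSpace X] [Nonempty X] :
    ∃ G : ℕ → X → ℝ, (∀ n, BLNormLEOne (G n)) ∧
      ∀ g, BLNormLEOne g → ∃ u : ℕ → ℕ, ∀ x,
        Tendsto (fun k => G (u k) x) atTop (𝓝 (g x)) := by
  let D := TopologicalSpace.denseSeq X
  let F : {g : X → ℝ // BLNormLEOne g} → ℕ → ℝ := fun g n => g.1 (D n)
  let _ : TopologicalSpace {g : X → ℝ // BLNormLEOne g} := .induced F inferInstance
  have : SecondCountableTopology {g : X → ℝ // BLNormLEOne g} :=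
    TopologicalSpace.secondCountableTopology_induced _ _ F
  have : Nonempty {g : X → ℝ // BLNormLEOne g} := ⟨⟨_, zero⟩⟩
  let G := TopologicalSpace.denseSeq {g : X → ℝ // BLNormLEOne g}
  refine ⟨fun n => (G n).1, fun n => (G n).2, fun g hg => ?_⟩
  obtain ⟨v, hv, hlim⟩ := mem_closure_iff_seq_limit.1
    (TopologicalSpace.denseRange_denseSeq {g : X → ℝ // BLNormLEOne g} ⟨g, hg⟩)
  choose u hu using hv
  refine ⟨u, tendsto_of_denseRange (TopologicalSpace.denseRange_denseSeq X)
    (fun k => (G (u k)).2) hg fun i => ?_⟩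
  have hF : Continuous F := continuous_induced_dom
  simpa [G, hu] using (tendsto_pi_nhds.1 ((hF.tendsto _).comp hlim)) i

end BLNormLEOne

section blDist

variable {X : Type*} [MetricSpace X] [MeasurableSpace X] (μ ν : Measure X)

lemma blDist_le {c : ℝ}
    (h : ∀ g : X → ℝ, BLNormLEOne g → |(∫ x, g x ∂μ) - ∫ x, g x ∂ν| ≤ c) :
    blDist μ ν ≤ c :=
  csSup_le ⟨_, _, .zero, rfl⟩ (by rintro _ ⟨g, hg, rfl⟩; exact h g hg)

variable [IsProbabilityMeasure μ] [IsProbabilityMeasure ν]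

lemma abs_integral_sub_le_blDist {g : X → ℝ} (hg : BLNormLEOne g) :
    |(∫ x, g x ∂μ) - ∫ x, g x ∂ν| ≤ blDist μ ν :=
  le_csSup ⟨2, by rintro _ ⟨g, hg, rfl⟩; exact hg.abs_integral_sub_le_two μ ν⟩ ⟨g, hg, rfl⟩

lemma blDist_nonneg : 0 ≤ blDist μ ν :=
  (abs_nonneg _).trans (abs_integral_sub_le_blDist μ ν .zero)

lemma blDist_le_of_seq [BorelSpace X] {G : ℕ → X → ℝ} (hG : ∀ n, BLNormLEOne (G n))
    (hdense : ∀ g, BLNormLEOne g → ∃ u : ℕ → ℕ, ∀ x,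
      Tendsto (fun k => G (u k) x) atTop (𝓝 (g x)))
    {c : ℝ} (h : ∀ n, |(∫ x, G n x ∂μ) - ∫ x, G n x ∂ν| ≤ c) : blDist μ ν ≤ c := by
  refine blDist_le μ ν fun g hg => ?_
  obtain ⟨u, hu⟩ := hdense g hg
  have key (τ : Measure X) [IsProbabilityMeasure τ] :
      Tendsto (fun k => ∫ x, G (u k) x ∂τ) atTop (𝓝 (∫ x, g x ∂τ)) :=
    tendsto_integral_of_dominated_convergence (fun _ => 1)
      (fun k => ((hG _).integrable τ).aestronglyMeasurable) (integrable_const _)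
      (fun k => ae_of_all _ (hG _).abs_le_one) (ae_of_all _ hu)
  exact le_of_tendsto' ((key μ).sub (key ν)).abs fun k => h (u k)

end blDist

namespace IsRCD

variable {Ω X : Type*} {A₀ m : MeasurableSpace Ω} [MetricSpace X] [MeasurableSpace X]
  {P : Measure Ω} {Z : Ω → X} {κ : Ω → Measure X}

lemma measurable (h : IsRCD P A₀ Z κ) : Measurable[A₀] κ :=
  @Measure.measurable_of_measurable_coe _ _ _ A₀ κ h.2.1

lemma stronglyMeasurable_integral (h : IsRCD P A₀ Z κ) {g : X → ℝ} (hg : StronglyMeasurable g) :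
    StronglyMeasurable[A₀] fun ω => ∫ x, g x ∂κ ω :=
  let K : @Kernel Ω X A₀ _ := @Kernel.mk _ _ A₀ _ κ h.measurable
  have : @IsMarkovKernel _ _ A₀ _ K := @IsMarkovKernel.mk _ _ A₀ _ K h.1
  hg.integral_kernel (κ := K)

variable [IsProbabilityMeasure P]

lemma setIntegral_integral (h : IsRCD P A₀ Z κ) (hA₀ : A₀ ≤ m) (hZ : Measurable Z) {g : X → ℝ}
    (hg : StronglyMeasurable g) (hgi : ∀ x, |g x| ≤ 1)
    {A : Set Ω} (hA : MeasurableSet[A₀] A) :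
    ∫ ω in A, ∫ x, g x ∂κ ω ∂P = ∫ ω in A, g (Z ω) ∂P := by
  let K : Kernel Ω X := ⟨κ, h.measurable.mono hA₀ le_rfl⟩
  have : IsMarkovKernel K := ⟨h.1⟩
  have hK : (K ∘ₖ Kernel.const Unit (P.restrict A)) () = (P.restrict A).map Z := by
    ext B hB
    rw [Kernel.comp_apply, Kernel.const_apply, Measure.bind_apply hB K.aemeasurable,
      Measure.map_apply hZ hB, Measure.restrict_apply (hZ hB), Set.inter_comm,
      ← ENNReal.toReal_eq_toReal_iff' _ (measure_ne_top _ _), ← h.2.2 A hA B hB,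
      integral_toReal]
    · rfl
    · exact (K.measurable_coe hB).aemeasurable
    · exact ae_of_all _ fun ω => measure_lt_top (K ω) B
    · refine ne_top_of_le_ne_top (measure_ne_top P A) ?_
      calc ∫⁻ ω in A, K ω B ∂P ≤ ∫⁻ ω in A, 1 ∂P := lintegral_mono fun ω => prob_le_one
        _ = P A := by simp
  have hint : Integrable g ((K ∘ₖ Kernel.const Unit (P.restrict A)) ()) := by
    rw [hK]
    exact .of_bound hg.aestronglyMeasurable 1 (ae_of_all _ hgi)
  have := Kernel.integral_comp hint
  rw [hK, integral_map hZ.aemeasurable hg.aestronglyMeasurable] at this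
  exact this.symm

lemma integral_ae_eq_condExp [BorelSpace X] (h : IsRCD P A₀ Z κ) (hA₀ : A₀ ≤ m)
    (hZ : Measurable Z) {g : X → ℝ} (hg : BLNormLEOne g) :
    (fun ω => ∫ x, g x ∂κ ω) =ᵐ[P] P[fun ω => g (Z ω) | A₀] := by
  have hgs : StronglyMeasurable g := hg.continuous.measurable.stronglyMeasurable
  have hsm := h.stronglyMeasurable_integral hgs
  refine ae_eq_condExp_of_forall_setIntegral_eq hA₀ ?_ (fun A _ _ => ?_)
    (fun A hA _ => h.setIntegral_integral hA₀ hZ hgs hg.abs_le_one hA) hsm.aestronglyMeasurable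
  · exact .of_bound (hgs.comp_measurable hZ).aestronglyMeasurable 1
      (ae_of_all _ fun ω => hg.abs_le_one _)
  · refine (Integrable.of_bound (hsm.mono hA₀).aestronglyMeasurable 1
      (ae_of_all _ fun ω => ?_)).integrableOn
    have := h.1 ω
    exact hg.abs_integral_le_one (κ ω)

lemma integrable_integral [BorelSpace X] (h : IsRCD P A₀ Z κ) (hA₀ : A₀ ≤ m)
    (hZ : Measurable Z) {g : X → ℝ} (hg : BLNormLEOne g) :
    Integrable (fun ω => ∫ x, g x ∂κ ω) P :=
  integrable_condExp.congr (h.integral_ae_eq_condExp hA₀ hZ hg).symm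

lemma integrable_blDist [BorelSpace X] [TopologicalSpace.SeparableSpace X]
    (h : IsRCD P A₀ Z κ) (hA₀ : A₀ ≤ m) (μ : Measure X) [IsProbabilityMeasure μ] :
    Integrable (fun ω => blDist μ (κ ω)) P := by
  have := nonempty_of_isProbabilityMeasure μ
  obtain ⟨G, hG, hdense⟩ := BLNormLEOne.exists_seq_pointwise_dense X
  have hprob := h.1
  have heq : (fun ω => blDist μ (κ ω)) =
      fun ω => ⨆ n, |(∫ x, G n x ∂μ) - ∫ x, G n x ∂κ ω| := by
    funext ω
    have hle n := abs_integral_sub_le_blDist μ (κ ω) (hG n)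
    exact le_antisymm (blDist_le_of_seq μ (κ ω) hG hdense fun n =>
      le_ciSup (f := fun n => |(∫ x, G n x ∂μ) - ∫ x, G n x ∂κ ω|)
        ⟨_, Set.forall_mem_range.2 hle⟩ n) (ciSup_le hle)
  have hmeas : Measurable fun ω => blDist μ (κ ω) := by
    rw [heq]
    refine Measurable.iSup fun n => (measurable_const.sub ?_).abs
    exact ((h.stronglyMeasurable_integral
      (hG n).continuous.measurable.stronglyMeasurable).mono hA₀).measurable
  refine .of_bound hmeas.aestronglyMeasurable 2 (ae_of_all _ fun ω => ?_)
  rw [Real.norm_of_nonneg (blDist_nonneg _ _)]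
  exact blDist_le _ _ fun g hg => hg.abs_integral_sub_le_two _ _

end IsRCD

/-- For nested sub-σ-algebras `A₁ ⊆ A₂` with regular conditional
distributions `μ₁`, `μ₂` for `Z`, one has `ρ(μ, μ₁(ω)) ≤ E[ρ(μ, μ₂(·)) | A₁](ω)` a.e.;
in particular `E[ρ(μ, μ₁(·))] ≤ E[ρ(μ, μ₂(·))]`. -/
theorem rcd_blDist_mono
    {X : Type*} [MetricSpace X] [CompleteSpace X] [TopologicalSpace.SeparableSpace X]
    [MeasurableSpace X] [BorelSpace X]
    {Ω : Type*} [m : MeasurableSpace Ω] (P : Measure Ω) [IsProbabilityMeasure P]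
    (Z : Ω → X) (hZ : Measurable Z)
    (A₁ A₂ : MeasurableSpace Ω) (h12 : A₁ ≤ A₂) (h2 : A₂ ≤ m)
    (μ₁ μ₂ : Ω → Measure X)
    (hμ₁ : IsRCD P A₁ Z μ₁) (hμ₂ : IsRCD P A₂ Z μ₂)
    (μ : Measure X) [IsProbabilityMeasure μ] :
    (∀ᵐ ω ∂P, blDist μ (μ₁ ω) ≤ (P[fun ω' => blDist μ (μ₂ ω')|A₁]) ω) ∧
      ∫ ω, blDist μ (μ₁ ω) ∂P ≤ ∫ ω, blDist μ (μ₂ ω) ∂P := by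
  have := nonempty_of_isProbabilityMeasure μ
  obtain ⟨G, hG, hdense⟩ := BLNormLEOne.exists_seq_pointwise_dense X
  have h1 := h12.trans h2
  have hint₁ := hμ₁.integrable_blDist h1 μ
  have hint₂ := hμ₂.integrable_blDist h2 μ
  have hprob₁ := hμ₁.1
  have hprob₂ := hμ₂.1
  have hcond : ∀ᵐ ω ∂P, blDist μ (μ₁ ω) ≤ (P[fun ω' => blDist μ (μ₂ ω')|A₁]) ω := by
    have hn (n : ℕ) : ∀ᵐ ω ∂P, |(∫ x, G n x ∂μ) - ∫ x, G n x ∂μ₁ ω| ≤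
        (P[fun ω' => blDist μ (μ₂ ω')|A₁]) ω := by
      have hi : Integrable (fun ω => ∫ x, G n x ∂μ₂ ω) P :=
        hμ₂.integrable_integral h2 hZ (hG n)
      have htower : (fun ω => ∫ x, G n x ∂μ₁ ω) =ᵐ[P] P[fun ω => ∫ x, G n x ∂μ₂ ω | A₁] :=
        (hμ₁.integral_ae_eq_condExp h1 hZ (hG n)).trans
          ((condExp_congr_ae (hμ₂.integral_ae_eq_condExp h2 hZ (hG n))).trans
            (condExp_condExp_of_le h12 h2)).symm
      have hc : Integrable (fun _ : Ω => ∫ x, G n x ∂μ) P := integrable_const _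
      have hle ω := abs_le.1 (abs_integral_sub_le_blDist μ (μ₂ ω) (hG n))
      have hsub := condExp_sub hc hi A₁
      have hsub' := condExp_sub hi hc A₁
      have hup := condExp_mono (m := A₁) (hc.sub hi) hint₂ (ae_of_all _ fun ω => (hle ω).2)
      have hdown := condExp_mono (m := A₁) (hi.sub hc) hint₂
        (ae_of_all _ fun ω => show (∫ x, G n x ∂μ₂ ω) - (∫ x, G n x ∂μ) ≤ _ by
          linarith [(hle ω).1])
      filter_upwards [htower, hsub, hsub', hup, hdown] with ω e₁ e₂ e₃ l₁ l₂
      rw [e₂] at l₁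
      rw [e₃] at l₂
      simp only [Pi.sub_apply, condExp_const h1] at l₁ l₂
      rw [e₁, abs_le]
      constructor <;> linarith
    filter_upwards [ae_all_iff.2 hn] with ω hω
    exact blDist_le_of_seq μ (μ₁ ω) hG hdense hω
  refine ⟨hcond, ?_⟩
  calc ∫ ω, blDist μ (μ₁ ω) ∂P ≤ ∫ ω, (P[fun ω' => blDist μ (μ₂ ω')|A₁]) ω ∂P :=
        integral_mono_ae hint₁ integrable_condExp hcond
    _ = ∫ ω, blDist μ (μ₂ ω) ∂P := integral_condExp h1
end

section
/- Let I be a closed bounded interval, and let f : I → ℝ be bounded and continuous at all but finitely many points of I. Let [a₁, a₂] ⊆ [b₁, b₂] ⊆ I. If f((a_i + b_i)/2) < (G_I f(a_i) + G_I f(b_i))/2 for i = 1, 2, then G_I f(x) = G_{[b₁,b₂]} f(x) for all x ∈ [a₁, a₂]. -/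
/-- The greatest convex minorant of `f` on the set `J`, evaluated at `x`:
the supremum of `g(x)` over all functions `g` convex on `J` with `g ≤ f` on `J`. -/
noncomputable def gcm (J : Set ℝ) (f : ℝ → ℝ) (x : ℝ) : ℝ :=
  sSup {v : ℝ | ∃ g : ℝ → ℝ, ConvexOn ℝ J g ∧ (∀ y ∈ J, g y ≤ f y) ∧ v = g x}

section GreatestConvexMinorant

variable {J : Set ℝ} {f : ℝ → ℝ}

lemma le_gcm {g : ℝ → ℝ} (hg : ConvexOn ℝ J g) (hgf : ∀ y ∈ J, g y ≤ f y) {x : ℝ} (hx : x ∈ J) :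
    g x ≤ gcm J f x := by
  refine le_csSup ⟨f x, ?_⟩ ⟨g, hg, hgf, rfl⟩
  rintro v ⟨g, -, h, rfl⟩
  exact h x hx

lemma gcm_le_of_forall_le (hJ : Convex ℝ J) (hf : ∃ M : ℝ, ∀ x ∈ J, |f x| ≤ M) {x c : ℝ}
    (h : ∀ g : ℝ → ℝ, ConvexOn ℝ J g → (∀ y ∈ J, g y ≤ f y) → g x ≤ c) : gcm J f x ≤ c := by
  obtain ⟨M, hM⟩ := hf
  refine csSup_le
    ⟨-M, fun _ ↦ -M, convexOn_const _ hJ, fun y hy ↦ neg_le_of_abs_le (hM y hy), rfl⟩ ?_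
  rintro v ⟨g, hg, hgf, rfl⟩
  exact h g hg hgf

lemma gcm_le (hJ : Convex ℝ J) (hf : ∃ M : ℝ, ∀ x ∈ J, |f x| ≤ M) {x : ℝ} (hx : x ∈ J) :
    gcm J f x ≤ f x :=
  gcm_le_of_forall_le hJ hf fun _ _ h ↦ h x hx

lemma convexOn_gcm (hJ : Convex ℝ J) (hf : ∃ M : ℝ, ∀ x ∈ J, |f x| ≤ M) :
    ConvexOn ℝ J (gcm J f) := by
  refine ⟨hJ, fun x hx y hy a b ha hb hab ↦ gcm_le_of_forall_le hJ hf fun g hg hgf ↦ ?_⟩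
  refine (hg.2 hx hy ha hb hab).trans ?_
  have h₁ := le_gcm hg hgf hx
  have h₂ := le_gcm hg hgf hy
  simp only [smul_eq_mul]
  gcongr

lemma gcm_le_gcm_of_subset {K : Set ℝ} (hJ : Convex ℝ J) (hf : ∃ M : ℝ, ∀ x ∈ J, |f x| ≤ M)
    (hK : Convex ℝ K) (hKJ : K ⊆ J) {x : ℝ} (hx : x ∈ K) : gcm J f x ≤ gcm K f x :=
  gcm_le_of_forall_le hJ hf fun _ hg hgf ↦
    le_gcm (hg.subset hKJ hK) (fun y hy ↦ hgf y (hKJ hy)) hx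

lemma convexOn_affine (hJ : Convex ℝ J) (c k x : ℝ) : ConvexOn ℝ J fun y ↦ c + k * (y - x) := by
  refine ⟨hJ, fun y _ z _ a b _ _ hab ↦ le_of_eq ?_⟩
  simp only [smul_eq_mul]
  linear_combination (k * x - c) * hab

/-- The three-point form of convexity, with denominators cleared. -/
lemma ConvexOn.sub_mul_le {g : ℝ → ℝ} (hg : ConvexOn ℝ J g) {x y z : ℝ} (hx : x ∈ J) (hz : z ∈ J)
    (hxy : x < y) (hyz : y < z) : (z - x) * g y ≤ (z - y) * g x + (y - x) * g z := by
  have h := hg.slope_mono_adjacent hx hz hxy hyz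
  rw [div_le_div_iff₀ (sub_pos.2 hxy) (sub_pos.2 hyz)] at h
  linarith

/-- A convex function on a real set has a supporting line at each interior point. -/
lemma ConvexOn.exists_supporting_line {g : ℝ → ℝ} (hg : ConvexOn ℝ J g) {x : ℝ}
    (hx : x ∈ interior J) : ∃ k : ℝ, ∀ y ∈ J, g x + k * (y - x) ≤ g y := by
  refine ⟨derivWithin g (Set.Ioi x) x, fun y hy ↦ ?_⟩
  rcases lt_trichotomy x y with h | rfl | h
  · have := hg.rightDeriv_le_slope_of_mem_interior hx hy h
    rw [slope_def_field, le_div_iff₀ (sub_pos.2 h)] at this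
    linarith
  · simp
  · have := (hg.slope_le_leftDeriv_of_mem_interior hy hx h).trans
      (hg.leftDeriv_le_rightDeriv_of_mem_interior hx)
    rw [slope_def_field, div_le_iff₀ (sub_pos.2 h)] at this
    linarith

/-- If `f` lies strictly below the midpoint of a chord of its greatest convex minorant, then `f`
comes arbitrarily close to that minorant over the chord. -/
lemma exists_le_gcm_add (hJ : Convex ℝ J) (hf : ∃ M : ℝ, ∀ x ∈ J, |f x| ≤ M) {s t : ℝ}
    (hs : s ∈ J) (ht : t ∈ J) (hst : s < t)
    (h : f ((s + t) / 2) < (gcm J f s + gcm J f t) / 2) {ε : ℝ} (hε : 0 < ε) :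
    ∃ p ∈ Set.Icc s t, f p ≤ gcm J f p + ε := by
  have hG := convexOn_gcm hJ hf
  have hsub : Set.Icc s t ⊆ J := hJ.ordConnected.out hs ht
  set G := gcm J f with hGdef
  obtain ⟨k, hk⟩ : ∃ k : ℝ, G t = G s + k * (t - s) :=
    ⟨(G t - G s) / (t - s), by field_simp [(sub_pos.2 hst).ne']; ring⟩
  have hmid : (s + t) / 2 ∈ Set.Icc s t := ⟨by linarith, by linarith⟩
  set S := (fun y ↦ f y - (G s + k * (y - s))) '' Set.Icc s t
  have hbdd : BddBelow S := by
    obtain ⟨M, hM⟩ := hf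
    refine ⟨-M - G s - |k| * (t - s), ?_⟩
    rintro _ ⟨y, hy, rfl⟩
    have h₁ := neg_le_of_abs_le (hM y (hsub hy))
    have h₂ : k * (y - s) ≤ |k| * (t - s) :=
      mul_le_mul (le_abs_self k) (by linarith [hy.2]) (by linarith [hy.1]) (abs_nonneg k)
    simp only
    linarith
  have hne : S.Nonempty := ⟨_, _, hmid, rfl⟩
  have hneg : sInf S ≤ 0 := by
    refine (csInf_le hbdd ⟨_, hmid, rfl⟩).trans ?_
    simp only
    linarith
  have hline : ∀ y ∈ J, G s + sInf S + k * (y - s) ≤ f y := by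
    intro y hy
    by_cases hyst : y ∈ Set.Icc s t
    · have := csInf_le hbdd ⟨y, hyst, rfl⟩
      simp only at this
      linarith
    · refine le_trans ?_ (gcm_le hJ hf hy)
      rw [← hGdef]
      rcases lt_or_ge y s with hys | hys
      · have := hG.sub_mul_le hy ht hys hst
        rw [hk] at this
        have : (t - s) * (G s + k * (y - s)) ≤ (t - s) * G y := by linarith
        linarith [le_of_mul_le_mul_left this (sub_pos.2 hst)]
      · have hty : t < y := by
          by_contra! hyt
          exact hyst ⟨hys, hyt⟩
        have := hG.sub_mul_le hs hy hst hty
        rw [hk] at this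
        have : (t - s) * (G s + k * (y - s)) ≤ (t - s) * G y := by linarith
        linarith [le_of_mul_le_mul_left this (sub_pos.2 hst)]
  obtain ⟨_, ⟨p, hp, rfl⟩, hpε⟩ := Real.lt_sInf_add_pos hne hε
  refine ⟨p, hp, ?_⟩
  have := le_gcm (convexOn_affine hJ _ k s) hline (hsub hp)
  simp only at hpε this
  linarith

end GreatestConvexMinorant

/-- localization of the greatest convex minorant. Let `f` be bounded
on `I = [l, u]` and continuous at all but finitely many points, and let
`[a₁, a₂] ⊆ [b₁, b₂] ⊆ I`. If `f((aᵢ+bᵢ)/2) < (G_I f(aᵢ) + G_I f(bᵢ))/2` for `i = 1, 2`,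
then `G_I f = G_{[b₁,b₂]} f` on `[a₁, a₂]`. -/
theorem gcm_localization
    (l u : ℝ) (hlu : l ≤ u) (f : ℝ → ℝ)
    (hbdd : ∃ M : ℝ, ∀ x ∈ Set.Icc l u, |f x| ≤ M)
    (hcont : ∃ s : Finset ℝ, ∀ x ∈ Set.Icc l u, x ∉ s →
      ContinuousWithinAt f (Set.Icc l u) x)
    (a₁ a₂ b₁ b₂ : ℝ)
    (hb₁ : l ≤ b₁) (hba₁ : b₁ ≤ a₁) (ha : a₁ ≤ a₂) (hab₂ : a₂ ≤ b₂) (hb₂ : b₂ ≤ u)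
    (h1 : f ((a₁ + b₁) / 2) <
      (gcm (Set.Icc l u) f a₁ + gcm (Set.Icc l u) f b₁) / 2)
    (h2 : f ((a₂ + b₂) / 2) <
      (gcm (Set.Icc l u) f a₂ + gcm (Set.Icc l u) f b₂) / 2) :
    ∀ x ∈ Set.Icc a₁ a₂, gcm (Set.Icc l u) f x = gcm (Set.Icc b₁ b₂) f x := by
  intro x ⟨hx₁, hx₂⟩
  have hI : Convex ℝ (Set.Icc l u) := convex_Icc l u
  have hK : Convex ℝ (Set.Icc b₁ b₂) := convex_Icc b₁ b₂
  have hKI : Set.Icc b₁ b₂ ⊆ Set.Icc l u := Set.Icc_subset_Icc hb₁ hb₂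
  have hbddK : ∃ M : ℝ, ∀ x ∈ Set.Icc b₁ b₂, |f x| ≤ M :=
    hbdd.imp fun M hM y hy ↦ hM y (hKI hy)
  have hxK : x ∈ Set.Icc b₁ b₂ := ⟨by linarith, by linarith⟩
  have ha₁I : a₁ ∈ Set.Icc l u := ⟨by linarith, by linarith⟩
  have ha₂I : a₂ ∈ Set.Icc l u := ⟨by linarith, by linarith⟩
  have hb₁I : b₁ ∈ Set.Icc l u := ⟨by linarith, by linarith⟩
  have hb₂I : b₂ ∈ Set.Icc l u := ⟨by linarith, by linarith⟩
  have hba₁' : b₁ < a₁ := by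
    refine lt_of_le_of_ne hba₁ ?_
    rintro rfl
    have := gcm_le hI hbdd hb₁I
    rw [add_self_div_two, add_self_div_two] at h1
    linarith
  have hab₂' : a₂ < b₂ := by
    refine lt_of_le_of_ne hab₂ ?_
    rintro rfl
    have := gcm_le hI hbdd hb₂I
    rw [add_self_div_two, add_self_div_two] at h2
    linarith
  refine le_antisymm (gcm_le_gcm_of_subset hI hbdd hK hKI hxK)
    (le_of_forall_pos_le_add fun ε hε ↦ ?_)
  rw [add_comm a₁ b₁, add_comm (gcm _ _ a₁)] at h1
  obtain ⟨p, hp, hpε⟩ := exists_le_gcm_add hI hbdd hb₁I ha₁I hba₁' h1 hε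
  obtain ⟨q, hq, hqε⟩ := exists_le_gcm_add hI hbdd ha₂I hb₂I hab₂' h2 hε
  have hpK : p ∈ Set.Icc b₁ b₂ := ⟨hp.1, by linarith [hp.2]⟩
  have hqK : q ∈ Set.Icc b₁ b₂ := ⟨by linarith [hq.1], hq.2⟩
  have hG := convexOn_gcm hI hbdd
  obtain ⟨k, hk⟩ := (convexOn_gcm hK hbddK).exists_supporting_line (x := x)
    (by rw [interior_Icc]; exact ⟨by linarith, by linarith⟩)
  have hp' := (hk p hpK).trans (gcm_le hK hbddK hpK)
  have hq' := (hk q hqK).trans (gcm_le hK hbddK hqK)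
  set G := gcm (Set.Icc l u) f with hGdef
  set H := gcm (Set.Icc b₁ b₂) f
  by_contra! hlt
  have hpx : p < x := by
    refine lt_of_le_of_ne (hp.2.trans hx₁) ?_
    rintro rfl
    simp only [sub_self, mul_zero] at hp'
    linarith
  have hxq : x < q := by
    refine lt_of_le_of_ne (hx₂.trans hq.1) ?_
    rintro rfl
    simp only [sub_self, mul_zero] at hq'
    linarith
  have hline : ∀ y ∈ Set.Icc l u, H x - ε + k * (y - x) ≤ f y := by
    intro y hy
    by_cases hyK : y ∈ Set.Icc b₁ b₂
    · linarith [hk y hyK, gcm_le hK hbddK hyK]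
    · refine le_trans ?_ (gcm_le hI hbdd hy)
      rw [← hGdef]
      rcases lt_or_ge y p with hyp | hyp
      · have h := hG.sub_mul_le hy (hKI hxK) hyp hpx
        have hGp := mul_le_mul_of_nonneg_left
          (show H x - ε + k * (p - x) ≤ G p by linarith) (by linarith : 0 ≤ x - y)
        have hGx := mul_le_mul_of_nonneg_left
          (show G x ≤ H x - ε by linarith) (by linarith : 0 ≤ p - y)
        refine le_of_mul_le_mul_left ?_ (sub_pos.2 hpx)
        linarith
      · have hqy : q < y := by
          by_contra! hyq
          exact hyK ⟨hp.1.trans hyp, hyq.trans hq.2⟩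
        have h := hG.sub_mul_le (hKI hxK) hy hxq hqy
        have hGq := mul_le_mul_of_nonneg_left
          (show H x - ε + k * (q - x) ≤ G q by linarith) (by linarith : 0 ≤ y - x)
        have hGx := mul_le_mul_of_nonneg_left
          (show G x ≤ H x - ε by linarith) (by linarith : 0 ≤ y - q)
        refine le_of_mul_le_mul_left ?_ (sub_pos.2 hxq)
        linarith
  have := le_gcm (convexOn_affine hI _ k x) hline (hKI hxK)
  simp only [sub_self, mul_zero, add_zero] at this
  linarith
end

section
/- Let the stationary setup hold and assume condition (MW). Let (t_n)_{n≥1} be any sequence in [0, 1]. For each n, let I_n = [−n^{1/3} t_n, n^{1/3}(1 − t_n)] and define W_n(s) = n^{−1/3} ( S_{⌊n t_n + n^{2/3} s⌋} − S_{⌊n t_n⌋} ) for s ∈ I_n, where for negative integers −m the partial sum is S_{−m} = −(X₀ + X_{−1} + ⋯ + X_{−m+1}). Then for every ε > 0 the random variables sup_{s ∈ I_n} ( |W_n(s)| − ε · min(s², |s|) ) are stochastically bounded: for every δ > 0 there exists c < ∞ such that P[ sup_{s ∈ I_n} ( |W_n(s)| − ε · min(s², |s|) ) > c ] ≤ δ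 for all n ≥ 1. -/
open MeasureTheory

lemma sq_lpNorm_two {Ω : Type*} [MeasurableSpace Ω] {P : Measure Ω} {f : Ω → ℝ}
    (hf : MemLp f 2 P) : lpNorm f 2 P ^ 2 = ∫ ω, f ω ^ 2 ∂P := by
  rw [lpNorm_eq_integral_norm_rpow_toReal (by norm_num) (by norm_num) hf.aestronglyMeasurable]
  have h0 : 0 ≤ ∫ ω, f ω ^ 2 ∂P := integral_nonneg fun ω => sq_nonneg _
  have h1 : (∫ ω, ‖f ω‖ ^ (2 : ENNReal).toReal ∂P) = ∫ ω, f ω ^ 2 ∂P := by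
    simp
  rw [h1, ← Real.rpow_natCast, ← Real.rpow_mul h0]
  norm_num

lemma lpNorm_two_le {Ω : Type*} [MeasurableSpace Ω] {P : Measure Ω} {f : Ω → ℝ} {B : ℝ}
    (hf : MemLp f 2 P) (hB : 0 ≤ B) (h : ∫ ω, f ω ^ 2 ∂P ≤ B ^ 2) : lpNorm f 2 P ≤ B := by
  rw [← sq_lpNorm_two hf] at h
  exact (pow_le_pow_iff_left₀ lpNorm_nonneg hB two_ne_zero).1 h

lemma lpNorm_congr_ae' {Ω : Type*} [MeasurableSpace Ω] {P : Measure Ω} {f g : Ω → ℝ}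
    (h : f =ᵐ[P] g) : lpNorm f 2 P = lpNorm g 2 P := by
  by_cases hf : AEStronglyMeasurable f P
  · rw [← toReal_eLpNorm hf, ← toReal_eLpNorm (hf.congr h), eLpNorm_congr_ae h]
  · rw [lpNorm_of_not_aestronglyMeasurable hf, lpNorm_of_not_aestronglyMeasurable
      (fun hg => hf (hg.congr h.symm))]

lemma lpNorm_condExp_le {Ω : Type*} {m m0 : MeasurableSpace Ω} {P : Measure Ω} {f : Ω → ℝ}
    (hf : MemLp f 2 P) : lpNorm (P[f|m]) 2 P ≤ lpNorm f 2 P := by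
  rw [← toReal_eLpNorm hf.aestronglyMeasurable,
    ← toReal_eLpNorm integrable_condExp.aestronglyMeasurable]
  exact ENNReal.toReal_mono hf.eLpNorm_ne_top (eLpNorm_condExp_le_eLpNorm f (by norm_num))

/-- The running maximum of the partial sums of a sequence, started at `0`. -/
def runningMax {Ω : Type*} (d : ℕ → Ω → ℝ) : ℕ → Ω → ℝ
  | 0 => 0
  | n + 1 => runningMax d n ⊔ fun ω => ∑ l ∈ Finset.range (n + 1), d l ω

lemma runningMax_mono {Ω : Type*} (d : ℕ → Ω → ℝ) (ω : Ω) :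
    Monotone fun n => runningMax d n ω :=
  monotone_nat_of_le_succ fun _ => le_sup_left

lemma runningMax_nonneg {Ω : Type*} (d : ℕ → Ω → ℝ) (n : ℕ) (ω : Ω) : 0 ≤ runningMax d n ω :=
  runningMax_mono d ω (Nat.zero_le n)

lemma sum_le_runningMax {Ω : Type*} (d : ℕ → Ω → ℝ) {i n : ℕ} (h : i ≤ n) (ω : Ω) :
    ∑ l ∈ Finset.range i, d l ω ≤ runningMax d n ω := by
  refine le_trans ?_ (runningMax_mono d ω h)
  cases i with
  | zero => simp [runningMax]
  | succ i => exact le_sup_right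

lemma runningMax_sq_le {Ω : Type*} (d : ℕ → Ω → ℝ) (n : ℕ) (ω : Ω) :
    runningMax d n ω ^ 2 + 2 * ∑ l ∈ Finset.range n, runningMax d l ω * d l ω ≤
      2 * runningMax d n ω * ∑ l ∈ Finset.range n, d l ω := by
  induction n with
  | zero => simp [runningMax]
  | succ n ih =>
    have h1 : runningMax d (n + 1) ω =
        max (runningMax d n ω) (∑ l ∈ Finset.range (n + 1), d l ω) := rfl
    rw [h1, Finset.sum_range_succ (fun l => d l ω),
      Finset.sum_range_succ (fun l => runningMax d l ω * d l ω)]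
    rcases max_cases (runningMax d n ω) (∑ l ∈ Finset.range n, d l ω + d n ω) with ⟨h, -⟩ | ⟨h, -⟩
    · rw [h]; linarith
    · rw [h]
      nlinarith [sq_nonneg (∑ l ∈ Finset.range n, d l ω + d n ω - runningMax d n ω)]

lemma memLp_runningMax {Ω : Type*} [MeasurableSpace Ω] {P : Measure Ω} {d : ℕ → Ω → ℝ}
    (hd : ∀ l, MemLp (d l) 2 P) (n : ℕ) : MemLp (runningMax d n) 2 P := by
  induction n with
  | zero => exact MemLp.zero
  | succ n ih => exact ih.sup (memLp_finsetSum _ fun l _ => hd l)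

lemma stronglyMeasurable_runningMax {Ω : Type*} {𝒢 : ℕ → MeasurableSpace Ω} (hmono : Monotone 𝒢)
    {d : ℕ → Ω → ℝ} (hd : ∀ l, StronglyMeasurable[𝒢 (l + 1)] (d l)) (n : ℕ) :
    StronglyMeasurable[𝒢 n] (runningMax d n) := by
  induction n with
  | zero => exact @stronglyMeasurable_zero Ω ℝ (𝒢 0) _ _
  | succ n ih =>
    have hs : StronglyMeasurable[𝒢 (n + 1)] fun ω => ∑ l ∈ Finset.range (n + 1), d l ω := by
      refine Finset.stronglyMeasurable_fun_sum _ fun l hl => (hd l).mono (hmono ?_)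
      simpa using hl
    have hi : StronglyMeasurable[𝒢 (n + 1)] (runningMax d n) := ih.mono (hmono n.le_succ)
    let _ := 𝒢 (n + 1)
    exact hi.sup hs

lemma integral_mul_eq_zero_of_condExp {Ω : Type*} {m m0 : MeasurableSpace Ω} {P : Measure Ω}
    [IsFiniteMeasure P] (hm : m ≤ m0) {f g : Ω → ℝ} (hf : StronglyMeasurable[m] f)
    (hf2 : MemLp f 2 P) (hg2 : MemLp g 2 P) (hg : P[g|m] =ᵐ[P] 0) :
    ∫ ω, f ω * g ω ∂P = 0 := by
  have h1 : P[f * g|m] =ᵐ[P] f * P[g|m] :=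
    condExp_mul_of_stronglyMeasurable_left hf (hf2.integrable_mul hg2)
      (hg2.integrable (by norm_num))
  have h2 : ∫ ω, (f * g) ω ∂P = 0 := by
    rw [← integral_condExp hm, integral_congr_ae h1, integral_eq_zero_of_ae]
    filter_upwards [hg] with ω h
    simp [h]
  exact h2

lemma integral_sq_runningMax_le {Ω : Type*} {m0 : MeasurableSpace Ω} {P : Measure Ω}
    [IsFiniteMeasure P] {𝒢 : ℕ → MeasurableSpace Ω} (hmono : Monotone 𝒢) (hle : ∀ n, 𝒢 n ≤ m0)
    {d : ℕ → Ω → ℝ} (hdm : ∀ l, StronglyMeasurable[𝒢 (l + 1)] (d l))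
    (hd : ∀ l, MemLp (d l) 2 P) (hd0 : ∀ l, P[d l|𝒢 l] =ᵐ[P] 0) (n : ℕ) :
    ∫ ω, runningMax d n ω ^ 2 ∂P ≤ 4 * ∫ ω, (∑ l ∈ Finset.range n, d l ω) ^ 2 ∂P := by
  have hM : MemLp (fun ω => ∑ l ∈ Finset.range n, d l ω) 2 P := memLp_finsetSum _ fun l _ => hd l
  have hA := memLp_runningMax hd
  have hAd : ∀ l, Integrable (fun ω => runningMax d l ω * d l ω) P :=
    fun l => (hA l).integrable_mul (hd l)
  have hpt : ∀ ω, runningMax d n ω ^ 2 ≤ 4 * (∑ l ∈ Finset.range n, d l ω) ^ 2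
      - 4 * ∑ l ∈ Finset.range n, runningMax d l ω * d l ω := fun ω => by
    nlinarith [runningMax_sq_le d n ω,
      sq_nonneg (runningMax d n ω - 2 * ∑ l ∈ Finset.range n, d l ω)]
  have hz : ∫ ω, ∑ l ∈ Finset.range n, runningMax d l ω * d l ω ∂P = 0 := by
    rw [integral_finsetSum _ fun l _ => hAd l]
    exact Finset.sum_eq_zero fun l _ => integral_mul_eq_zero_of_condExp (hle l)
      (stronglyMeasurable_runningMax hmono hdm l) (hA l) (hd l) (hd0 l)
  have hs : Integrable (fun ω => ∑ l ∈ Finset.range n, runningMax d l ω * d l ω) P :=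
    integrable_finsetSum _ fun l _ => hAd l
  calc ∫ ω, runningMax d n ω ^ 2 ∂P
      ≤ ∫ ω, (4 * (∑ l ∈ Finset.range n, d l ω) ^ 2
        - 4 * ∑ l ∈ Finset.range n, runningMax d l ω * d l ω) ∂P :=
        integral_mono (hA n).integrable_sq ((hM.integrable_sq.const_mul 4).sub (hs.const_mul 4)) hpt
    _ = _ := by
        rw [integral_sub (hM.integrable_sq.const_mul 4) (hs.const_mul 4), integral_const_mul,
          integral_const_mul, hz]
        ring

lemma integral_sq_sum_le {Ω : Type*} {m0 : MeasurableSpace Ω} {P : Measure Ω}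
    [IsFiniteMeasure P] {𝒢 : ℕ → MeasurableSpace Ω} (hmono : Monotone 𝒢) (hle : ∀ n, 𝒢 n ≤ m0)
    {d : ℕ → Ω → ℝ} (hdm : ∀ l, StronglyMeasurable[𝒢 (l + 1)] (d l))
    (hd : ∀ l, MemLp (d l) 2 P) (hd0 : ∀ l, P[d l|𝒢 l] =ᵐ[P] 0) {b : ℝ}
    (hb : ∀ l, lpNorm (d l) 2 P ≤ b) (n : ℕ) :
    ∫ ω, (∑ l ∈ Finset.range n, d l ω) ^ 2 ∂P ≤ n * b ^ 2 := by
  have hM : ∀ n, MemLp (fun ω => ∑ l ∈ Finset.range n, d l ω) 2 P :=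
    fun n => memLp_finsetSum _ fun l _ => hd l
  induction n with
  | zero => simp
  | succ n ih =>
    have hz : ∫ ω, (∑ l ∈ Finset.range n, d l ω) * d n ω ∂P = 0 := by
      refine integral_mul_eq_zero_of_condExp (hle n) ?_ (hM n) (hd n) (hd0 n)
      refine Finset.stronglyMeasurable_fun_sum _ fun l hl => (hdm l).mono (hmono ?_)
      simpa using hl
    have hi : Integrable (fun ω => (∑ l ∈ Finset.range n, d l ω) * d n ω) P :=
      (hM n).integrable_mul (hd n)
    have he : ∀ ω, (∑ l ∈ Finset.range (n + 1), d l ω) ^ 2 = (∑ l ∈ Finset.range n, d l ω) ^ 2 +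
        2 * ((∑ l ∈ Finset.range n, d l ω) * d n ω) + d n ω ^ 2 := fun ω => by
      rw [Finset.sum_range_succ]; ring
    simp_rw [he]
    rw [integral_add (f := fun ω => (∑ l ∈ Finset.range n, d l ω) ^ 2 +
        2 * ((∑ l ∈ Finset.range n, d l ω) * d n ω))
        ((hM n).integrable_sq.add (hi.const_mul 2)) (hd n).integrable_sq,
      integral_add (hM n).integrable_sq (hi.const_mul 2), integral_const_mul, hz,
      ← sq_lpNorm_two (hd n)]
    have := pow_le_pow_left₀ lpNorm_nonneg (hb n) 2
    push_cast
    linarith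

/-- The partial sums of `Z` up to time `N` are dominated in absolute value by a single function
whose `L²` norm is at most `B`. -/
def HasMaxBound {Ω : Type*} [MeasurableSpace Ω] (P : Measure Ω) (Z : ℕ → Ω → ℝ) (N : ℕ) (B : ℝ) :
    Prop :=
  ∃ G : Ω → ℝ, MemLp G 2 P ∧ lpNorm G 2 P ≤ B ∧
    ∀ ω, ∀ i ≤ N, |∑ l ∈ Finset.range i, Z l ω| ≤ G ω

lemma HasMaxBound.mono {Ω : Type*} [MeasurableSpace Ω] {P : Measure Ω} {Z : ℕ → Ω → ℝ} {N : ℕ}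
    {B C : ℝ} (h : HasMaxBound P Z N B) (hBC : B ≤ C) : HasMaxBound P Z N C :=
  let ⟨G, h1, h2, h3⟩ := h
  ⟨G, h1, h2.trans hBC, h3⟩

lemma HasMaxBound.add {Ω : Type*} [MeasurableSpace Ω] {P : Measure Ω} {Y Z : ℕ → Ω → ℝ} {N : ℕ}
    {B C : ℝ} (hY : HasMaxBound P Y N B) (hZ : HasMaxBound P Z N C) :
    HasMaxBound P (fun l ω => Y l ω + Z l ω) N (B + C) := by
  obtain ⟨G, h1, h2, h3⟩ := hY
  obtain ⟨H, g1, g2, g3⟩ := hZ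
  refine ⟨G + H, h1.add g1, (lpNorm_add_le h1 (by norm_num)).trans (add_le_add h2 g2), ?_⟩
  intro ω i hi
  rw [Finset.sum_add_distrib]
  exact (abs_add_le _ _).trans (add_le_add (h3 ω i hi) (g3 ω i hi))

/-- Doob's `L²` maximal inequality for martingale differences. -/
lemma hasMaxBound_of_condExp_eq_zero {Ω : Type*} {m0 : MeasurableSpace Ω} {P : Measure Ω}
    [IsFiniteMeasure P] {𝒢 : ℕ → MeasurableSpace Ω} (hmono : Monotone 𝒢) (hle : ∀ n, 𝒢 n ≤ m0)
    {d : ℕ → Ω → ℝ} (hdm : ∀ l, StronglyMeasurable[𝒢 (l + 1)] (d l))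
    (hd : ∀ l, MemLp (d l) 2 P) (hd0 : ∀ l, P[d l|𝒢 l] =ᵐ[P] 0) {b : ℝ}
    (hb : ∀ l, lpNorm (d l) 2 P ≤ b) (n : ℕ) :
    HasMaxBound P d n (4 * √n * b) := by
  have hb0 : 0 ≤ b := lpNorm_nonneg.trans (hb 0)
  have key : ∀ e : ℕ → Ω → ℝ, (∀ l, StronglyMeasurable[𝒢 (l + 1)] (e l)) →
      (∀ l, MemLp (e l) 2 P) → (∀ l, P[e l|𝒢 l] =ᵐ[P] 0) → (∀ l, lpNorm (e l) 2 P ≤ b) →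
      lpNorm (runningMax e n) 2 P ≤ 2 * √n * b := fun e h1 h2 h3 h4 => by
    refine lpNorm_two_le (memLp_runningMax h2 n) (by positivity) ?_
    refine (integral_sq_runningMax_le hmono hle h1 h2 h3 n).trans ?_
    have := integral_sq_sum_le hmono hle h1 h2 h3 h4 n
    rw [mul_pow, mul_pow, Real.sq_sqrt (Nat.cast_nonneg n)]
    linarith
  have hn : ∀ l, P[-d l|𝒢 l] =ᵐ[P] 0 := fun l => by
    filter_upwards [condExp_neg (d l) (𝒢 l) (μ := P), hd0 l] with ω h1 h2
    simp [h1, h2]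
  have k1 := key d hdm hd hd0 hb
  have k2 := key (fun l => -d l) (fun l => (hdm l).neg) (fun l => (hd l).neg) hn
    (fun l => by rw [lpNorm_neg]; exact hb l)
  have m1 := memLp_runningMax hd n
  have m2 := memLp_runningMax (d := fun l => -d l) (fun l => (hd l).neg) n
  refine ⟨_, m1.add m2, (lpNorm_add_le m1 (by norm_num)).trans (by linarith), ?_⟩
  intro ω i hi
  have a1 := sum_le_runningMax d hi ω
  have a2 := sum_le_runningMax (fun l => -d l) hi ω
  have b1 := runningMax_nonneg d n ω
  have b2 := runningMax_nonneg (fun l => -d l) n ω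
  simp only [Pi.neg_apply, Finset.sum_neg_distrib] at a2
  rw [Pi.add_apply, abs_le]
  constructor <;> linarith

lemma HasMaxBound.of_pairs {Ω : Type*} [MeasurableSpace Ω] {P : Measure Ω} {Y : ℕ → Ω → ℝ}
    {N : ℕ} {B b : ℝ} (hY : ∀ l, MemLp (Y l) 2 P) (hb : ∀ l, lpNorm (Y l) 2 P ≤ b)
    (h : HasMaxBound P (fun l ω => Y (2 * l) ω + Y (2 * l + 1) ω) N B) :
    HasMaxBound P Y (2 * N) (B + √N * b) := by
  have hb0 : 0 ≤ b := lpNorm_nonneg.trans (hb 0)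
  obtain ⟨G, h1, h2, h3⟩ := h
  set H : Ω → ℝ := fun ω => √(∑ j ∈ Finset.range N, Y (2 * j) ω ^ 2) with hH
  have hHsq : ∀ ω, H ω ^ 2 = ∑ j ∈ Finset.range N, Y (2 * j) ω ^ 2 :=
    fun ω => Real.sq_sqrt (Finset.sum_nonneg fun j _ => sq_nonneg _)
  have hYint : ∀ j ∈ Finset.range N, Integrable (fun ω => Y (2 * j) ω ^ 2) P :=
    fun j _ => (hY _).integrable_sq
  have hHm : AEStronglyMeasurable H P :=
    Real.continuous_sqrt.comp_aestronglyMeasurable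
      (integrable_finsetSum _ hYint).aestronglyMeasurable
  have hHL : MemLp H 2 P := by
    rw [memLp_two_iff_integrable_sq hHm]
    simp_rw [hHsq]
    exact integrable_finsetSum _ hYint
  have hHn : lpNorm H 2 P ≤ √N * b := by
    refine lpNorm_two_le hHL (by positivity) ?_
    simp_rw [hHsq]
    rw [integral_finsetSum _ hYint, mul_pow, Real.sq_sqrt (Nat.cast_nonneg N)]
    calc _ ≤ ∑ j ∈ Finset.range N, b ^ 2 := Finset.sum_le_sum fun j _ => by
          rw [← sq_lpNorm_two (hY _)]
          exact pow_le_pow_left₀ lpNorm_nonneg (hb _) 2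
      _ = _ := by simp
  have hsum : ∀ ω j, ∑ l ∈ Finset.range (2 * j), Y l ω =
      ∑ l ∈ Finset.range j, (Y (2 * l) ω + Y (2 * l + 1) ω) := fun ω j => by
    induction j with
    | zero => simp
    | succ j ih =>
      rw [mul_add, mul_one, Finset.sum_range_succ, Finset.sum_range_succ, ih,
        Finset.sum_range_succ, add_assoc]
  refine ⟨G + H, h1.add hHL, (lpNorm_add_le h1 (by norm_num)).trans (add_le_add h2 hHn), ?_⟩
  intro ω i hi
  have hH0 : 0 ≤ H ω := Real.sqrt_nonneg _
  rcases Nat.even_or_odd' i with ⟨j, rfl | rfl⟩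
  · rw [hsum]
    exact (h3 ω j (by omega)).trans (by simp [hH0])
  · rw [Finset.sum_range_succ, hsum]
    refine (abs_add_le _ _).trans (add_le_add (h3 ω j (by omega)) ?_)
    refine Real.abs_le_sqrt ?_
    exact Finset.single_le_sum (f := fun j => Y (2 * j) ω ^ 2) (fun _ _ => sq_nonneg _)
      (Finset.mem_range.2 (by omega))

lemma lpNorm_sub_condExp_le {Ω : Type*} {m m0 : MeasurableSpace Ω} {P : Measure Ω} {f : Ω → ℝ}
    {b : ℝ} (hf : MemLp f 2 P) (hb : lpNorm f 2 P ≤ b) : lpNorm (f - P[f|m]) 2 P ≤ 2 * b := by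
  have h1 := lpNorm_sub_le (g := P[f|m]) hf (by norm_num)
  have h2 := lpNorm_condExp_le (m := m) hf
  linarith

lemma condExp_sub_condExp_self {Ω : Type*} {m m0 : MeasurableSpace Ω} {P : Measure Ω}
    [IsFiniteMeasure P] (hm : m ≤ m0) {f : Ω → ℝ} (hf : Integrable f P) :
    P[f - P[f|m]|m] =ᵐ[P] 0 := by
  filter_upwards [condExp_sub hf (integrable_condExp (m := m) (f := f)) m,
    condExp_condExp_of_le (f := f) (μ := P) le_rfl hm] with ω h1 h2
  simp [h1, h2]

lemma sqrt_natCast_two_pow (m : ℕ) : √((2 ^ m : ℕ) : ℝ) = √2 ^ m := by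
  rw [Real.sqrt_eq_iff_mul_self_eq (by positivity) (by positivity), ← mul_pow,
    Real.mul_self_sqrt (by norm_num)]
  norm_num

lemma condExp_sum_condExp_pairs {Ω : Type*} {m0 : MeasurableSpace Ω} {P : Measure Ω}
    [IsFiniteMeasure P] {𝒢 : ℕ → MeasurableSpace Ω} (hmono : Monotone 𝒢) (hle : ∀ n, 𝒢 n ≤ m0)
    {Z : ℕ → Ω → ℝ} (hZ : ∀ l, Integrable (Z l) P) (n b : ℕ) :
    P[fun ω => ∑ l ∈ Finset.range n, ((P[Z (2 * (n * b + l))|𝒢 (2 * (n * b + l))]) ω +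
      (P[Z (2 * (n * b + l) + 1)|𝒢 (2 * (n * b + l) + 1)]) ω)|𝒢 (2 * (n * b))] =ᵐ[P]
    P[fun ω => ∑ l ∈ Finset.range (2 * n), Z (2 * n * b + l) ω|𝒢 (2 * n * b)] := by
  have hs : ∀ (f : ℕ → ℝ) (k : ℕ), ∑ l ∈ Finset.range (2 * k), f l =
      ∑ l ∈ Finset.range k, (f (2 * l) + f (2 * l + 1)) := fun f k => by
    induction k with
    | zero => simp
    | succ k ih =>
      rw [mul_add, mul_one, Finset.sum_range_succ, Finset.sum_range_succ, ih,
        Finset.sum_range_succ, add_assoc]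
  have e1 : (fun ω => ∑ l ∈ Finset.range n, ((P[Z (2 * (n * b + l))|𝒢 (2 * (n * b + l))]) ω +
      (P[Z (2 * (n * b + l) + 1)|𝒢 (2 * (n * b + l) + 1)]) ω)) =
      ∑ l ∈ Finset.range (2 * n), P[Z (2 * n * b + l)|𝒢 (2 * n * b + l)] := by
    ext ω
    rw [Finset.sum_apply, hs (fun l => (P[Z (2 * n * b + l)|𝒢 (2 * n * b + l)]) ω)]
    refine Finset.sum_congr rfl fun l _ => ?_
    rw [show 2 * n * b + 2 * l = 2 * (n * b + l) by ring,
      show 2 * n * b + (2 * l + 1) = 2 * (n * b + l) + 1 by ring]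
  have e2 : (fun ω => ∑ l ∈ Finset.range (2 * n), Z (2 * n * b + l) ω) =
      ∑ l ∈ Finset.range (2 * n), Z (2 * n * b + l) := by
    ext ω; rw [Finset.sum_apply]
  rw [e1, e2, ← mul_assoc]
  refine (condExp_finsetSum (fun l _ => integrable_condExp) _).trans ?_
  refine .trans ?_ (condExp_finsetSum (fun l _ => hZ _) _).symm
  refine eventuallyEq_sum fun l _ => ?_
  exact condExp_condExp_of_le (hmono (by omega)) (hle _)

/-- A maximal inequality for adapted sequences along powers of two, in terms of the conditional
expectations of dyadic blocks. -/
lemma hasMaxBound_two_pow {Ω : Type*} {m0 : MeasurableSpace Ω} {P : Measure Ω}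
    [IsFiniteMeasure P] (m : ℕ) :
    ∀ {𝒢 : ℕ → MeasurableSpace Ω} {Z : ℕ → Ω → ℝ} {ζ : ℝ} {z : ℕ → ℝ},
    Monotone 𝒢 → (∀ n, 𝒢 n ≤ m0) → (∀ l, StronglyMeasurable[𝒢 (l + 1)] (Z l)) →
    (∀ l, MemLp (Z l) 2 P) → (∀ l, lpNorm (Z l) 2 P ≤ ζ) →
    (∀ j b, lpNorm (P[fun ω => ∑ l ∈ Finset.range (2 ^ j), Z (2 ^ j * b + l) ω|𝒢 (2 ^ j * b)]) 2 P
      ≤ z j) →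
    HasMaxBound P Z (2 ^ m) (8 * √2 ^ m * (ζ + 3 * ∑ j ∈ Finset.range m, z j / √2 ^ j)) := by
  induction m with
  | zero =>
    intro 𝒢 Z ζ z _ _ _ hZ hζ _
    refine ⟨fun ω => |Z 0 ω|, (hZ 0).abs, ?_, fun ω i hi => ?_⟩
    · have h1 : lpNorm (fun ω => |Z 0 ω|) 2 P = lpNorm (Z 0) 2 P :=
        lpNorm_fun_abs (hZ 0).aestronglyMeasurable 2
      have h2 : 0 ≤ lpNorm (Z 0) 2 P := lpNorm_nonneg
      have h3 := hζ 0
      rw [h1]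
      simp
      linarith
    · rw [pow_zero] at hi
      interval_cases i <;> simp
  | succ m ih =>
    intro 𝒢 Z ζ z hmono hle hZm hZ hζ hz
    set Y : ℕ → Ω → ℝ := fun l => P[Z l|𝒢 l] with hY
    have hYL : ∀ l, MemLp (Y l) 2 P := fun l => (hZ l).condExp (by norm_num)
    have hYz : ∀ l, lpNorm (Y l) 2 P ≤ z 0 := fun l => by
      have := hz 0 l
      simpa using this
    have hYm : ∀ l, StronglyMeasurable[𝒢 l] (Y l) := fun l => stronglyMeasurable_condExp
    have hd : HasMaxBound P (fun l => Z l - Y l) (2 ^ (m + 1)) (4 * √2 ^ (m + 1) * (2 * ζ)) := by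
      rw [← sqrt_natCast_two_pow]
      exact hasMaxBound_of_condExp_eq_zero hmono hle
        (fun l => (hZm l).sub ((hYm l).mono (hmono l.le_succ))) (fun l => (hZ l).sub (hYL l))
        (fun l => condExp_sub_condExp_self (hle l) ((hZ l).integrable (by norm_num)))
        (fun l => lpNorm_sub_condExp_le (hZ l) (hζ l)) _
    have hpair := ih (𝒢 := fun l => 𝒢 (2 * l))
      (Z := fun l ω => Y (2 * l) ω + Y (2 * l + 1) ω) (ζ := 2 * z 0) (z := fun j => z (j + 1))
      (fun a b h => hmono (by omega)) (fun n => hle _)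
      (fun l => ((hYm _).mono (hmono (by omega))).add ((hYm _).mono (hmono (by omega))))
      (fun l => (hYL _).add (hYL _))
      (fun l => (lpNorm_add_le (hYL _) (by norm_num)).trans
        (by linarith [hYz (2 * l), hYz (2 * l + 1)]))
      (fun j b => by
        have h := hz (j + 1) b
        rw [pow_succ'] at h
        refine le_trans (le_of_eq (lpNorm_congr_ae' ?_)) h
        exact condExp_sum_condExp_pairs hmono hle (fun l => (hZ l).integrable (by norm_num)) _ _)
    have hpairs := hpair.of_pairs hYL hYz
    rw [← pow_succ'] at hpairs
    have hfin := hd.add hpairs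
    rw [sqrt_natCast_two_pow] at hfin
    have hZe : (fun l ω => (fun l => Z l - Y l) l ω + Y l ω) = Z := by
      ext l ω; simp
    rw [hZe] at hfin
    refine hfin.mono ?_
    have hz0 : 0 ≤ z 0 := lpNorm_nonneg.trans (hYz 0)
    have hs1 : 1 ≤ √2 := Real.one_le_sqrt.2 (by norm_num)
    have hs0 : √2 ≠ 0 := by positivity
    have htail : ∑ j ∈ Finset.range m, z (j + 1) / √2 ^ j =
        √2 * ∑ j ∈ Finset.range m, z (j + 1) / √2 ^ (j + 1) := by
      rw [Finset.mul_sum]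
      refine Finset.sum_congr rfl fun j _ => ?_
      rw [pow_succ]
      field_simp
    rw [Finset.sum_range_succ', htail]
    set q := ∑ j ∈ Finset.range m, z (j + 1) / √2 ^ (j + 1)
    have hp : 0 ≤ √2 ^ m := by positivity
    have hpz : 0 ≤ √2 ^ m * z 0 := by positivity
    rw [pow_succ]
    simp only [pow_zero, div_one]
    nlinarith [mul_le_mul_of_nonneg_right hs1 hpz]

lemma condExp_comp_comap {Ω : Type*} {m m0 : MeasurableSpace Ω} {P : Measure Ω}
    [IsFiniteMeasure P] (hm : m ≤ m0) {T : Ω → Ω} (hT : MeasurePreserving T P P) {f : Ω → ℝ}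
    (hf : Integrable f P) :
    P[f ∘ T|m.comap T] =ᵐ[P] P[f|m] ∘ T := by
  have hle : m.comap T ≤ m0 := by
    rintro s ⟨t, ht, rfl⟩
    exact hT.measurable (hm t ht)
  have hTm : @Measurable Ω Ω (m.comap T) m T := comap_measurable T
  have hc : Integrable (P[f|m] ∘ T) P := hT.integrable_comp_of_integrable integrable_condExp
  have hset : ∀ g : Ω → ℝ, Integrable g P → ∀ t, MeasurableSet t →
      ∫ ω in T ⁻¹' t, (g ∘ T) ω ∂P = ∫ ω in t, g ω ∂P := fun g hg t ht => by
    have h : AEStronglyMeasurable g (P.map T) := by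
      rw [hT.map_eq]
      exact hg.aestronglyMeasurable
    have h' := setIntegral_map ht h hT.measurable.aemeasurable
    rw [hT.map_eq] at h'
    exact h'.symm
  refine (ae_eq_condExp_of_forall_setIntegral_eq hle (hT.integrable_comp_of_integrable hf)
    (fun s _ _ => hc.integrableOn) ?_ ?_).symm
  · rintro s ⟨t, ht, rfl⟩ -
    rw [hset _ integrable_condExp t (hm t ht), hset f hf t (hm t ht), setIntegral_condExp hm hf ht]
  · exact (stronglyMeasurable_condExp.comp_measurable hTm).aestronglyMeasurable

lemma exists_sum_dyadic_le {v : ℕ → ℝ} (hv0 : ∀ n, 0 ≤ v n) (hv : ∀ n k, v n ≤ v (n + k) + v k)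
    (hs : Summable fun n : ℕ => ((n : ℝ) + 1) ^ (-(3 : ℝ) / 2) * v (n + 1)) :
    ∃ C : ℝ, ∀ m, ∑ j ∈ Finset.range m, v (2 ^ j) / √2 ^ j ≤ C := by
  set w : ℕ → ℝ := fun k => (k : ℝ) ^ (-(3 : ℝ) / 2) * v k with hw
  have hw0 : ∀ k, 0 ≤ w k := fun k => mul_nonneg (by positivity) (hv0 k)
  have hws : Summable w := by
    rw [← summable_nat_add_iff 1]
    simpa [hw] using hs
  have hblock : ∀ j, v (2 ^ j) / √2 ^ j ≤
      8 * (∑ k ∈ Finset.Ico (2 ^ j) (2 ^ (j + 1)), w k +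
        ∑ k ∈ Finset.Ico (2 ^ (j + 1)) (2 ^ (j + 1 + 1)), w k) := fun j => by
    rw [Finset.sum_Ico_consecutive _ (Nat.pow_le_pow_right (by norm_num) (by omega))
      (Nat.pow_le_pow_right (by norm_num) (by omega))]
    rw [← sqrt_natCast_two_pow, show 2 ^ (j + 1 + 1) = 4 * 2 ^ j by ring]
    have hN : 0 < 2 ^ j := by positivity
    generalize 2 ^ j = N at hN
    have hNr : (0 : ℝ) < N := by exact_mod_cast hN
    have hsq : 0 < √(N : ℝ) := Real.sqrt_pos.2 hNr
    have h1 : N * v N ≤ ∑ k ∈ Finset.Ico N (4 * N), v k := by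
      calc N * v N = ∑ k ∈ Finset.Ico N (2 * N), v N := by
            rw [Finset.sum_const, Nat.card_Ico, two_mul, Nat.add_sub_cancel, nsmul_eq_mul]
        _ ≤ ∑ k ∈ Finset.Ico N (2 * N), (v k + v (N + k)) :=
            Finset.sum_le_sum fun k _ => (hv N k).trans (by rw [add_comm])
        _ = ∑ k ∈ Finset.Ico N (2 * N), v k + ∑ k ∈ Finset.Ico (N + N) (2 * N + N), v k := by
            rw [Finset.sum_add_distrib, ← Finset.sum_Ico_add]
        _ ≤ ∑ k ∈ Finset.Ico N (2 * N), v k + ∑ k ∈ Finset.Ico (2 * N) (4 * N), v k := by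
            refine add_le_add le_rfl (Finset.sum_le_sum_of_subset_of_nonneg ?_ fun _ _ _ => hv0 _)
            exact Finset.Ico_subset_Ico (by omega) (by omega)
        _ = _ := Finset.sum_Ico_consecutive _ (by omega) (by omega)
    have h2 : ∑ k ∈ Finset.Ico N (4 * N), v k ≤
        8 * (N * √N) * ∑ k ∈ Finset.Ico N (4 * N), w k := by
      rw [Finset.mul_sum]
      refine Finset.sum_le_sum fun k hk => ?_
      rw [Finset.mem_Ico] at hk
      have hk0 : (0 : ℝ) < k := by exact_mod_cast hN.trans_le hk.1
      have hk4 : (k : ℝ) ≤ 4 * N := by exact_mod_cast hk.2.le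
      have hvk : v k = (k : ℝ) ^ ((3 : ℝ) / 2) * w k := by
        rw [hw]
        simp only
        rw [← mul_assoc, ← Real.rpow_add hk0]
        norm_num
      rw [hvk]
      refine mul_le_mul_of_nonneg_right ?_ (hw0 k)
      calc (k : ℝ) ^ ((3 : ℝ) / 2) ≤ (4 * N : ℝ) ^ ((3 : ℝ) / 2) := by gcongr
        _ = (4 * N) * √(4 * N) := by
            rw [show (3 : ℝ) / 2 = 1 + 1 / 2 by norm_num, Real.rpow_add (by positivity),
              Real.rpow_one, ← Real.sqrt_eq_rpow]
        _ = 8 * (N * √N) := by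
            rw [Real.sqrt_mul (by norm_num), show √(4 : ℝ) = 2 by
              rw [show (4 : ℝ) = 2 ^ 2 by norm_num]; exact Real.sqrt_sq (by norm_num)]
            ring
    rw [div_le_iff₀ hsq]
    have h3 := h1.trans h2
    refine le_of_mul_le_mul_left (h3.trans (le_of_eq ?_)) hNr
    ring
  have htel : ∀ m, ∑ j ∈ Finset.range m, ∑ k ∈ Finset.Ico (2 ^ j) (2 ^ (j + 1)), w k ≤
      ∑' k, w k := fun m => by
    have : ∑ j ∈ Finset.range m, ∑ k ∈ Finset.Ico (2 ^ j) (2 ^ (j + 1)), w k =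
        ∑ k ∈ Finset.Ico 1 (2 ^ m), w k := by
      induction m with
      | zero => simp
      | succ m ih =>
        rw [Finset.sum_range_succ, ih, Finset.sum_Ico_consecutive _ Nat.one_le_two_pow
          (Nat.pow_le_pow_right (by norm_num) (by omega))]
    rw [this]
    exact hws.sum_le_tsum _ fun k _ => hw0 k
  refine ⟨16 * ∑' k, w k, fun m => (Finset.sum_le_sum fun j _ => hblock j).trans ?_⟩
  rw [← Finset.mul_sum, Finset.sum_add_distrib]
  have h1 := htel m
  have h2 := htel (m + 1)
  rw [Finset.sum_range_succ'] at h2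
  have h3 : 0 ≤ ∑ k ∈ Finset.Ico (2 ^ 0) (2 ^ (0 + 1)), w k := Finset.sum_nonneg fun k _ => hw0 k
  linarith

lemma measure_setOf_le_of_lpNorm_le {Ω : Type*} [MeasurableSpace Ω] {P : Measure Ω} {G : Ω → ℝ}
    (hG : MemLp G 2 P) {B r : ℝ} (hB : lpNorm G 2 P ≤ B) (hr : 0 < r) :
    P {ω | r ≤ G ω} ≤ ENNReal.ofReal (B ^ 2 / r ^ 2) := by
  have h := meas_ge_le_mul_pow_eLpNorm_enorm P (p := 2) (by norm_num) (by norm_num)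
    hG.aestronglyMeasurable (ε := ENNReal.ofReal r) (by simpa using hr) (by simp)
  refine (measure_mono fun ω hω => ?_).trans (h.trans ?_)
  · simp only [Set.mem_ofPred_eq] at hω ⊢
    rw [← ofReal_norm]
    exact ENNReal.ofReal_le_ofReal (hω.trans (Real.le_norm_self _))
  · rw [← ofReal_lpNorm hG, ← ENNReal.ofReal_inv_of_pos hr,
      ENNReal.ofReal_rpow_of_nonneg (by positivity) (by norm_num),
      ENNReal.ofReal_rpow_of_nonneg lpNorm_nonneg (by norm_num),
      ← ENNReal.ofReal_mul (by positivity)]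
    refine ENNReal.ofReal_le_ofReal ?_
    simp only [ENNReal.toReal_ofNat, Real.rpow_ofNat]
    rw [inv_pow, div_eq_inv_mul]
    gcongr
    exact lpNorm_nonneg

/-- The `σ`-algebra generated by the variables `X j`, `j ≤ k`. -/
@[reducible] def pastSigma {Ω : Type*} (X : ℤ → Ω → ℝ) (k : ℤ) : MeasurableSpace Ω :=
  ⨆ j ∈ Set.Iic k, MeasurableSpace.comap (X j) (borel ℝ)

lemma pastSigma_mono {Ω : Type*} (X : ℤ → Ω → ℝ) : Monotone (pastSigma X) :=
  fun _ _ h => biSup_mono fun _ hj => le_trans hj h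

lemma pastSigma_le {Ω : Type*} {m0 : MeasurableSpace Ω} {X : ℤ → Ω → ℝ}
    (hX : ∀ k, Measurable (X k)) (k : ℤ) : pastSigma X k ≤ m0 :=
  iSup₂_le fun j _ => (hX j).comap_le

lemma stronglyMeasurable_pastSigma {Ω : Type*} (X : ℤ → Ω → ℝ) (k : ℤ) :
    StronglyMeasurable[pastSigma X k] (X k) := by
  let _ := pastSigma X k
  refine Measurable.stronglyMeasurable (measurable_iff_comap_le.2 ?_)
  exact le_iSup₂ (f := fun j (_ : j ∈ Set.Iic k) => MeasurableSpace.comap (X j) (borel ℝ)) k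
    (Set.mem_Iic.2 le_rfl)

lemma pastSigma_comap {Ω : Type*} {X : ℤ → Ω → ℝ} {T : Ω → Ω}
    (hshift : ∀ k : ℤ, ∀ ω, X (k + 1) ω = X k (T ω)) (k : ℤ) :
    (pastSigma X k).comap T = pastSigma X (k + 1) := by
  have h : ∀ j, MeasurableSpace.comap T (MeasurableSpace.comap (X j) (borel ℝ)) =
      MeasurableSpace.comap (X (j + 1)) (borel ℝ) := fun j => by
    rw [MeasurableSpace.comap_comp]
    congr 1
    ext ω
    exact (hshift j ω).symm
  simp only [pastSigma, MeasurableSpace.comap_iSup, h]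
  refine le_antisymm (iSup₂_le fun j hj => ?_) (iSup₂_le fun j hj => ?_)
  · exact le_iSup₂ (f := fun j (_ : j ∈ Set.Iic (k + 1)) => MeasurableSpace.comap (X j) (borel ℝ))
      (j + 1) (by simpa using hj)
  · obtain ⟨i, rfl⟩ : ∃ i, j = i + 1 := ⟨j - 1, by ring⟩
    exact le_iSup₂ (f := fun j (_ : j ∈ Set.Iic k) => MeasurableSpace.comap (X (j + 1)) (borel ℝ))
      i (by simpa using hj)

/-- The sum of the `m` variables following time `a`. -/
def blockSum {Ω : Type*} (X : ℤ → Ω → ℝ) (a : ℤ) (m : ℕ) : Ω → ℝ :=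
  fun ω => ∑ l ∈ Finset.range m, X (a + l + 1) ω

lemma blockSum_eq_sub {Ω : Type*} {X S : ℤ → Ω → ℝ}
    (hSrec : ∀ k : ℤ, ∀ ω, S (k + 1) ω = S k ω + X (k + 1) ω) (a : ℤ) (m : ℕ) (ω : Ω) :
    blockSum X a m ω = S (a + m) ω - S a ω := by
  induction m with
  | zero => simp [blockSum]
  | succ m ih =>
    rw [blockSum] at ih ⊢
    rw [Finset.sum_range_succ, ih]
    push_cast
    rw [← add_assoc, hSrec]
    ring

lemma blockSum_add {Ω : Type*} (X : ℤ → Ω → ℝ) (a : ℤ) (n k : ℕ) :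
    blockSum X a (n + k) = blockSum X a n + blockSum X (a + n) k := by
  ext ω
  simp only [blockSum, Pi.add_apply]
  rw [Finset.sum_range_add]
  congr 1
  refine Finset.sum_congr rfl fun l _ => ?_
  exact congrFun (congrArg X (by push_cast; ring)) ω

lemma lpNorm_comp_measurePreserving' {Ω : Type*} [MeasurableSpace Ω] {P : Measure Ω} {T : Ω → Ω}
    (hT : MeasurePreserving T P P) {f : Ω → ℝ} (hf : AEStronglyMeasurable f P) :
    lpNorm (f ∘ T) 2 P = lpNorm f 2 P := by
  rw [← toReal_eLpNorm hf, ← toReal_eLpNorm (hf.comp_measurePreserving hT),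
    eLpNorm_comp_measurePreserving hf hT]

lemma eq_of_int_succ {α : Type*} {f : ℤ → α} (h : ∀ k, f (k + 1) = f k) (k : ℤ) : f k = f 0 := by
  induction k using Int.induction_on with
  | zero => rfl
  | succ n ih => rw [h, ih]
  | pred n ih => rw [← ih, ← h (-n - 1)]; simp

/-- Under the Maxwell–Woodroofe condition, the maximal partial sum over a dyadic block of length
`2 ^ m` has `L²` norm of order `√(2 ^ m)`, uniformly in the location of the block. -/
lemma exists_hasMaxBound_of_maxwellWoodroofe {Ω : Type*} [MeasurableSpace Ω] {P : Measure Ω}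
    [IsProbabilityMeasure P] {T : Ω → Ω} (hT : MeasurePreserving T P P) {X : ℤ → Ω → ℝ}
    (hX : ∀ k, Measurable (X k)) (hshift : ∀ k : ℤ, ∀ ω, X (k + 1) ω = X k (T ω))
    (hX2 : MemLp (X 0) 2 P)
    (hMW : Summable fun n : ℕ => ((n : ℝ) + 1) ^ (-(3 : ℝ) / 2) *
      lpNorm (P[blockSum X 0 (n + 1)|pastSigma X 0]) 2 P) :
    ∃ C : ℝ, 0 ≤ C ∧
      ∀ (a : ℤ) (m : ℕ), HasMaxBound P (fun l => X (a + l + 1)) (2 ^ m) (C * √2 ^ m) := by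
  have hXc : ∀ k, X (k + 1) = X k ∘ T := fun k => funext fun ω => hshift k ω
  have hXn : ∀ k, eLpNorm (X k) 2 P = eLpNorm (X 0) 2 P := eq_of_int_succ fun k => by
    rw [hXc, eLpNorm_comp_measurePreserving (hX k).aestronglyMeasurable hT]
  have hXL : ∀ k, MemLp (X k) 2 P := fun k =>
    ⟨(hX k).aestronglyMeasurable, by rw [hXn]; exact hX2.2⟩
  have hXl : ∀ k, lpNorm (X k) 2 P = lpNorm (X 0) 2 P := fun k => by
    rw [← toReal_eLpNorm (hX k).aestronglyMeasurable, hXn,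
      toReal_eLpNorm (hX 0).aestronglyMeasurable]
  have hbL : ∀ a m, MemLp (blockSum X a m) 2 P := fun a m => memLp_finsetSum _ fun l _ => hXL _
  have hbI : ∀ a m, Integrable (blockSum X a m) P := fun a m => (hbL a m).integrable (by norm_num)
  have hle : ∀ k, pastSigma X k ≤ _ := pastSigma_le hX
  set v : ℕ → ℝ := fun m => lpNorm (P[blockSum X 0 m|pastSigma X 0]) 2 P with hv
  have hva : ∀ a m, lpNorm (P[blockSum X a m|pastSigma X a]) 2 P = v m := fun a m => by
    refine eq_of_int_succ (f := fun a => lpNorm (P[blockSum X a m|pastSigma X a]) 2 P)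
      (fun k => ?_) a
    have hb : blockSum X (k + 1) m = blockSum X k m ∘ T := by
      ext ω
      simp only [blockSum, Function.comp_apply]
      refine Finset.sum_congr rfl fun l _ => ?_
      rw [← hshift, add_right_comm k 1]
    have hb' : P[blockSum X (k + 1) m|pastSigma X (k + 1)] =ᵐ[P]
        P[blockSum X k m|pastSigma X k] ∘ T := by
      rw [hb, ← pastSigma_comap hshift]
      exact condExp_comp_comap (hle k) hT (hbI k m)
    rw [lpNorm_congr_ae' hb', lpNorm_comp_measurePreserving' hT
      integrable_condExp.aestronglyMeasurable]
  have hvsub : ∀ n k, v n ≤ v (n + k) + v k := fun n k => by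
    have h1 : P[blockSum X 0 n|pastSigma X 0] =ᵐ[P] P[blockSum X 0 (n + k)|pastSigma X 0] -
        P[P[blockSum X n k|pastSigma X n]|pastSigma X 0] := by
      rw [blockSum_add, zero_add]
      filter_upwards [condExp_add (hbI 0 n) (hbI n k) (pastSigma X 0),
        condExp_condExp_of_le (f := blockSum X n k) (μ := P)
          (pastSigma_mono X (Int.natCast_nonneg n)) (hle n)] with ω h1 h2
      rw [Pi.sub_apply, h1, h2, Pi.add_apply]
      ring
    have h2 : MemLp (P[blockSum X n k|pastSigma X n]) 2 P := (hbL n k).condExp (by norm_num)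
    calc v n = _ := lpNorm_congr_ae' h1
      _ ≤ _ := lpNorm_sub_le ((hbL 0 (n + k)).condExp (by norm_num)) (by norm_num)
      _ ≤ v (n + k) + v k := add_le_add le_rfl ((lpNorm_condExp_le h2).trans (hva n k).le)
  obtain ⟨C, hC⟩ := exists_sum_dyadic_le (fun n => lpNorm_nonneg) hvsub hMW
  have hC0 : 0 ≤ C := by simpa using hC 0
  have hX0 : 0 ≤ lpNorm (X 0) 2 P := lpNorm_nonneg
  refine ⟨8 * (lpNorm (X 0) 2 P + 3 * C), by positivity, fun a m => ?_⟩
  have hmain := hasMaxBound_two_pow (P := P) m (𝒢 := fun l => pastSigma X (a + l))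
    (Z := fun l => X (a + l + 1)) (ζ := lpNorm (X 0) 2 P) (z := fun j => v (2 ^ j))
    (fun i j h => pastSigma_mono X (by simpa using h)) (fun n => hle _)
    (fun l => by
      have := stronglyMeasurable_pastSigma X (a + l + 1)
      rwa [add_assoc a, ← Nat.cast_succ] at this ⊢)
    (fun l => hXL _) (fun l => (hXl _).le)
    (fun j b => by
      refine le_of_eq (Eq.trans ?_ (hva (a + (2 ^ j * b : ℕ)) (2 ^ j)))
      congr 2
      ext ω
      simp only [blockSum]
      refine Finset.sum_congr rfl fun l _ => ?_
      exact congrFun (congrArg X (by push_cast; ring)) ω)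
  refine hmain.mono ?_
  have := hC m
  calc _ ≤ 8 * √2 ^ m * (lpNorm (X 0) 2 P + 3 * C) := by gcongr
    _ = _ := by ring

lemma exists_measure_increment_le {Ω : Type*} [MeasurableSpace Ω] {P : Measure Ω}
    {X S : ℤ → Ω → ℝ} (hSrec : ∀ k : ℤ, ∀ ω, S (k + 1) ω = S k ω + X (k + 1) ω) {C : ℝ}
    (h : ∀ (a : ℤ) (m : ℕ), HasMaxBound P (fun l => X (a + l + 1)) (2 ^ m) (C * √2 ^ m))
    (a : ℤ) {H r : ℝ} (hH : 1 ≤ H) (hr : 0 < r) :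
    P {ω | ∃ k : ℤ, |((k - a : ℤ) : ℝ)| ≤ H ∧ r ≤ |S k ω - S a ω|} ≤
      ENNReal.ofReal (16 * C ^ 2 * H / r ^ 2) := by
  have hN0 : ⌊H⌋₊ ≠ 0 := (Nat.floor_pos.2 hH).ne'
  have hNH : (⌊H⌋₊ : ℝ) ≤ H := Nat.floor_le (by linarith)
  set N := ⌊H⌋₊ with hN
  have hm1 := Nat.pow_log_le_self 2 hN0
  have hm2 : N < 2 ^ (Nat.log 2 N + 1) := Nat.lt_pow_succ_log_self (by norm_num) N
  set m := Nat.log 2 N + 2 with hm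
  obtain ⟨G, hG, hGn, hGb⟩ := h (a - N) m
  have hG' : ∀ ω, ∀ i : ℕ, i ≤ 2 ^ m → |S (a - N + i) ω - S (a - N) ω| ≤ G ω := fun ω i hi => by
    rw [← blockSum_eq_sub hSrec]
    exact hGb ω i hi
  have h2N : 2 * N ≤ 2 ^ m := by rw [hm, pow_succ]; omega
  have h4N : 2 ^ m ≤ 4 * N := by rw [hm, pow_add]; omega
  refine (measure_mono ?_).trans
    ((measure_setOf_le_of_lpNorm_le hG hGn (half_pos hr)).trans (ENNReal.ofReal_le_ofReal ?_))
  · rintro ω ⟨k, hk, hrk⟩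
    have hkN : (k - a).natAbs ≤ N := by
      refine Nat.le_floor ?_
      rwa [Nat.cast_natAbs, Int.cast_abs]
    have e1 := hG' ω N (by omega)
    have e2 := hG' ω (k - a + N).toNat (by omega)
    rw [sub_add_cancel] at e1
    rw [show a - N + ((k - a + N).toNat : ℤ) = k by omega] at e2
    have e3 := abs_sub_le (S k ω) (S (a - N) ω) (S a ω)
    rw [abs_sub_comm (S (a - N) ω)] at e3
    simp only [Set.mem_ofPred_eq]
    linarith
  · have h4 : ((2 : ℝ) ^ m) ≤ 4 * H := by
      have : ((2 ^ m : ℕ) : ℝ) ≤ ((4 * N : ℕ) : ℝ) := by exact_mod_cast h4N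
      push_cast at this
      linarith
    rw [mul_pow, ← pow_mul, mul_comm m 2, pow_mul, Real.sq_sqrt (by norm_num),
      div_pow, div_div_eq_mul_div]
    refine div_le_div_of_nonneg_right ?_ (sq_nonneg r)
    nlinarith [mul_le_mul_of_nonneg_left h4 (sq_nonneg C)]

lemma exists_tsum_dyadic_le {K ε δ : ℝ} (hK : 0 ≤ K) (hε : 0 < ε) (hδ : 0 < δ) :
    ∃ x : ℝ, 0 < x ∧ (Summable fun j : ℕ => K * 2 ^ j / (x + ε * (2 ^ j / 2)) ^ 2) ∧
      ∑' j : ℕ, K * 2 ^ j / (x + ε * (2 ^ j / 2)) ^ 2 ≤ δ := by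
  have hsum : Summable fun j : ℕ => 4 * K / ε ^ 2 * (1 / 2 : ℝ) ^ j :=
    summable_geometric_two.mul_left _
  have hbound : ∀ x : ℝ, 0 < x → ∀ j : ℕ, ‖K * 2 ^ j / (x + ε * (2 ^ j / 2)) ^ 2‖ ≤
      4 * K / ε ^ 2 * (1 / 2 : ℝ) ^ j := fun x hx j => by
    rw [Real.norm_of_nonneg (by positivity)]
    calc K * 2 ^ j / (x + ε * (2 ^ j / 2)) ^ 2 ≤ K * 2 ^ j / (ε * (2 ^ j / 2)) ^ 2 := by
          gcongr
          linarith
      _ = _ := by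
          rw [div_pow, one_pow]
          field_simp
          norm_num
  have ht : Filter.Tendsto (fun x : ℝ => ∑' j : ℕ, K * 2 ^ j / (x + ε * (2 ^ j / 2)) ^ 2)
      Filter.atTop (nhds (∑' _ : ℕ, (0 : ℝ))) := by
    refine tendsto_tsum_of_dominated_convergence hsum (fun j => ?_) ?_
    · refine Filter.Tendsto.div_atTop tendsto_const_nhds ?_
      exact (Filter.tendsto_pow_atTop two_ne_zero).comp
        (Filter.tendsto_atTop_add_const_right _ _ Filter.tendsto_id)
    · filter_upwards [Filter.eventually_gt_atTop 0] with x hx j using hbound x hx j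
  rw [tsum_zero] at ht
  obtain ⟨x, hx, hx0⟩ :=
    ((ht.eventually (gt_mem_nhds hδ)).and (Filter.eventually_gt_atTop 0)).exists
  exact ⟨x, hx0, Summable.of_norm_bounded hsum (hbound x hx0), hx.le⟩

lemma exists_two_pow_bounds {y : ℝ} (hy : 0 ≤ y) : ∃ j : ℕ, y ≤ 2 ^ j ∧ (2 : ℝ) ^ j / 2 - 1 ≤ y := by
  rcases le_total y 1 with h | h
  · exact ⟨0, by simpa using h, by norm_num; linarith⟩
  · obtain ⟨n, h1, h2⟩ := exists_nat_pow_near h (y := 2) (by norm_num)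
    refine ⟨n + 1, h2.le, ?_⟩
    rw [pow_succ]
    linarith

lemma abs_intCast_floor_sub_floor_le (x y : ℝ) : |((⌊x + y⌋ - ⌊x⌋ : ℤ) : ℝ)| ≤ |y| + 1 := by
  have h1 := Int.floor_le (x + y)
  have h2 := Int.lt_floor_add_one (x + y)
  have h3 := Int.floor_le x
  have h4 := Int.lt_floor_add_one x
  have h5 := neg_abs_le y
  have h6 := le_abs_self y
  push_cast
  rw [abs_le]
  constructor <;> linarith

/-- Under the stationary setup and condition (MW), the random variables
`sup_{s ∈ Iₙ} (|Wₙ(s)| - ε min(s², |s|))` are stochastically bounded, where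
`Wₙ(s) = n^{-1/3}(S_{⌊n tₙ + n^{2/3} s⌋} - S_{⌊n tₙ⌋})` and
`Iₙ = [-n^{1/3} tₙ, n^{1/3}(1 - tₙ)]`. -/
theorem W_n_stochastically_bounded
    {Ω : Type*} [MeasurableSpace Ω] (P : Measure Ω) [IsProbabilityMeasure P]
    (T : Ω ≃ᵐ Ω) (hT : MeasurePreserving T P P)
    (X : ℤ → Ω → ℝ) (hX0meas : Measurable (X 0))
    (hshift : ∀ k : ℤ, ∀ ω, X (k + 1) ω = X k (T ω))
    (hX2 : Integrable (fun ω => (X 0 ω) ^ 2) P)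
    (hmean : ∫ ω, X 0 ω ∂P = 0)
    (S : ℤ → Ω → ℝ) (hS0 : ∀ ω, S 0 ω = 0)
    (hSrec : ∀ k : ℤ, ∀ ω, S (k + 1) ω = S k ω + X (k + 1) ω)
    (F0 : MeasurableSpace Ω)
    (hF0 : F0 = ⨆ k ∈ Set.Iic (0 : ℤ), MeasurableSpace.comap (X k) (borel ℝ))
    (hMW : Summable (fun n : ℕ => ((n : ℝ) + 1) ^ (-(3 : ℝ) / 2) *
      Real.sqrt (∫ ω, ((P[S ((n : ℤ) + 1)|F0]) ω) ^ 2 ∂P)))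
    (t : ℕ → ℝ) (ht : ∀ n, t n ∈ Set.Icc (0 : ℝ) 1)
    (W : ℕ → ℝ → Ω → ℝ)
    (hW : ∀ n s ω, W n s ω = (n : ℝ) ^ (-(1 : ℝ) / 3) *
      (S ⌊(n : ℝ) * t n + (n : ℝ) ^ ((2 : ℝ) / 3) * s⌋ ω - S ⌊(n : ℝ) * t n⌋ ω)) :
    ∀ ε : ℝ, 0 < ε → ∀ δ : ℝ, 0 < δ → ∃ c : ℝ, ∀ n : ℕ, 1 ≤ n →
      P {ω | ∃ s ∈ Set.Icc (-(n : ℝ) ^ ((1 : ℝ) / 3) * t n)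
          ((n : ℝ) ^ ((1 : ℝ) / 3) * (1 - t n)),
          c < |W n s ω| - ε * min (s ^ 2) |s|} ≤ ENNReal.ofReal δ := by
  intro ε hε δ hδ
  subst hF0
  have hXc : ∀ k, X (k + 1) = X k ∘ T := fun k => funext fun ω => hshift k ω
  have hXm : ∀ k, Measurable (X k) := fun k => by
    induction k using Int.induction_on with
    | zero => exact hX0meas
    | succ n ih => rw [hXc]; exact ih.comp T.measurable
    | pred n ih =>
      have h := hXc (-n - 1)
      rw [sub_add_cancel] at h
      have h' : X (-n - 1) = X (-n) ∘ T.symm := by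
        ext ω
        rw [h]
        simp
      rw [h']
      exact ih.comp T.symm.measurable
  have hX0L : MemLp (X 0) 2 P :=
    (memLp_two_iff_integrable_sq hX0meas.aestronglyMeasurable).2 hX2
  have hXL : ∀ n : ℕ, MemLp (X n) 2 P := fun n => by
    induction n with
    | zero => exact hX0L
    | succ n ih =>
      push_cast
      rw [hXc]
      exact ih.comp_measurePreserving hT
  have hblock : ∀ n : ℕ, blockSum X 0 (n + 1) = S ((n : ℤ) + 1) := fun n => by
    ext ω
    rw [blockSum_eq_sub hSrec, hS0, sub_zero, zero_add]
    push_cast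
    rfl
  have hMW' : Summable fun n : ℕ => ((n : ℝ) + 1) ^ (-(3 : ℝ) / 2) *
      lpNorm (P[blockSum X 0 (n + 1)|pastSigma X 0]) 2 P := by
    refine hMW.congr fun n => ?_
    have hL : MemLp (blockSum X 0 (n + 1)) 2 P := memLp_finsetSum _ fun l _ => by
      have := hXL (l + 1)
      rwa [zero_add, ← Nat.cast_succ]
    rw [hblock] at hL ⊢
    rw [← sq_lpNorm_two (hL.condExp (by norm_num)), Real.sqrt_sq lpNorm_nonneg]
  obtain ⟨C, hC0, hC⟩ := exists_hasMaxBound_of_maxwellWoodroofe hT hXm hshift hX0L hMW'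
  obtain ⟨x, hx0, hxs, hx⟩ := exists_tsum_dyadic_le (K := 32 * C ^ 2) (by positivity) hε hδ
  refine ⟨x + 2 * ε, fun n hn => ?_⟩
  have hn1 : (1 : ℝ) ≤ n := by exact_mod_cast hn
  have hq1 : 1 ≤ (n : ℝ) ^ ((1 : ℝ) / 3) := Real.one_le_rpow hn1 (by norm_num)
  have hq2 : (n : ℝ) ^ ((2 : ℝ) / 3) = ((n : ℝ) ^ ((1 : ℝ) / 3)) ^ 2 := by
    rw [← Real.rpow_natCast, ← Real.rpow_mul (by positivity)]
    norm_num
  have hq3 : (n : ℝ) ^ (-(1 : ℝ) / 3) = ((n : ℝ) ^ ((1 : ℝ) / 3))⁻¹ := by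
    rw [← Real.rpow_neg (by positivity)]
    norm_num
  simp only [hW, hq2, hq3]
  generalize (n : ℝ) ^ ((1 : ℝ) / 3) = q at hq1
  have hq0 : 0 < q := by linarith
  set a := ⌊(n : ℝ) * t n⌋ with ha
  set E : ℕ → Set Ω := fun j => {ω | ∃ k : ℤ, |((k - a : ℤ) : ℝ)| ≤ 2 * (q ^ 2 * 2 ^ j) ∧
    q * (x + ε * (2 ^ j / 2)) ≤ |S k ω - S a ω|} with hE
  have hEle : ∀ j, P (E j) ≤
      ENNReal.ofReal (32 * C ^ 2 * 2 ^ j / (x + ε * (2 ^ j / 2)) ^ 2) := fun j => by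
    have h2 : (1 : ℝ) ≤ q ^ 2 * 2 ^ j :=
      one_le_mul_of_one_le_of_one_le (one_le_pow₀ hq1) (one_le_pow₀ (by norm_num))
    refine (exists_measure_increment_le hSrec hC a (by linarith) (by positivity)).trans_eq ?_
    congr 1
    field_simp
    ring
  have hsub : {ω | ∃ s ∈ Set.Icc (-q * t n) (q * (1 - t n)),
      x + 2 * ε < |q⁻¹ * (S ⌊(n : ℝ) * t n + q ^ 2 * s⌋ ω - S a ω)| - ε * min (s ^ 2) |s|} ⊆
      ⋃ j, E j := by
    rintro ω ⟨s, -, hs⟩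
    obtain ⟨j, hj1, hj2⟩ := exists_two_pow_bounds (abs_nonneg s)
    refine Set.mem_iUnion.2 ⟨j, ⌊(n : ℝ) * t n + q ^ 2 * s⌋, ?_, ?_⟩
    · refine (abs_intCast_floor_sub_floor_le _ _).trans ?_
      rw [abs_mul, abs_of_nonneg (sq_nonneg q)]
      have h1 : q ^ 2 * |s| ≤ q ^ 2 * 2 ^ j := by gcongr
      have h2 : (1 : ℝ) ≤ q ^ 2 * 2 ^ j :=
        one_le_mul_of_one_le_of_one_le (one_le_pow₀ hq1) (one_le_pow₀ (by norm_num))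
      linarith
    · have hmin : |s| - 1 ≤ min (s ^ 2) |s| := by
        refine le_min ?_ (by linarith)
        nlinarith [sq_abs s, sq_nonneg (|s| - 1)]
      have h1 : ε * (2 ^ j / 2 - 2) ≤ ε * min (s ^ 2) |s| := by
        gcongr
        linarith
      rw [abs_mul, abs_of_pos (inv_pos.2 hq0)] at hs
      have h2 : x + ε * (2 ^ j / 2) ≤
          q⁻¹ * |S ⌊(n : ℝ) * t n + q ^ 2 * s⌋ ω - S a ω| := by linarith
      rwa [inv_mul_eq_div, le_div_iff₀' hq0] at h2
  calc _ ≤ P (⋃ j, E j) := measure_mono hsub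
    _ ≤ ∑' j, P (E j) := measure_iUnion_le _
    _ ≤ ∑' j, ENNReal.ofReal (32 * C ^ 2 * 2 ^ j / (x + ε * (2 ^ j / 2)) ^ 2) :=
        ENNReal.tsum_le_tsum hEle
    _ = ENNReal.ofReal (∑' j, 32 * C ^ 2 * 2 ^ j / (x + ε * (2 ^ j / 2)) ^ 2) :=
        (ENNReal.ofReal_tsum_of_nonneg (fun j => by positivity) hxs).symm
    _ ≤ ENNReal.ofReal δ := ENNReal.ofReal_le_ofReal hx
end

section
/- Let φ : [0,1] → ℝ be continuous and nondecreasing, let t₀ ∈ (0, 1], and suppose φ is continuously differentiable on a neighborhood of t₀ in [0,1]. Let t_n ∈ (0, 1] with t_n → t₀, let Φ(t) = ∫₀^t φ(s) ds, and for s ∈ I_n = [−n^{1/3} t_n, n^{1/3}(1 − t_n)] define Ψ_n(s) = n^{2/3} [ Φ(t_n + n^{−1/3} s) − Φ(t_n) − φ(t_n) n^{−1/3} s ]. Then for every compact interval [a, b] ⊂ ℝ, sup_{s ∈ [a,b] ∩ I_n} | Ψ_n(s) − (1/2) φ′(t₀) s² | → 0 as n → ∞. -/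
/-- On a convex set where the derivative of `φ` is within `ε` of `c`, the increment of `φ` is
affine of slope `c` up to an error `ε * |y - x|`. -/
theorem abs_sub_sub_mul_le_of_abs_deriv_sub_le {K : Set ℝ} (hK : Convex ℝ K) {φ d : ℝ → ℝ}
    {c ε : ℝ} (hd : ∀ z ∈ K, HasDerivWithinAt φ (d z) K z) (hb : ∀ z ∈ K, |d z - c| ≤ ε)
    {x y : ℝ} (hx : x ∈ K) (hy : y ∈ K) :
    |φ y - φ x - c * (y - x)| ≤ ε * |y - x| := by
  have hderiv : ∀ z ∈ K, HasDerivWithinAt (fun v => φ v - c * v) (d z - c) K z := fun z hz => by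
    simpa using (hd z hz).fun_sub ((hasDerivWithinAt_id z K).const_mul c)
  have h := hK.norm_image_sub_le_of_norm_hasDerivWithin_le hderiv hb hx hy
  simp only [Real.norm_eq_abs] at h
  convert h using 2
  ring

/-- On a convex set where the derivative of `φ` is within `ε` of `c`, a primitive of `φ` agrees
with its second-order expansion with quadratic coefficient `c / 2` up to `ε * (y - x) ^ 2`. -/
theorem abs_integral_sub_quadratic_le {K : Set ℝ} (hK : Convex ℝ K) {φ d : ℝ → ℝ}
    {c ε : ℝ} (hd : ∀ z ∈ K, HasDerivWithinAt φ (d z) K z) (hb : ∀ z ∈ K, |d z - c| ≤ ε)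
    {x y : ℝ} (hx : x ∈ K) (hy : y ∈ K) :
    |(∫ v in x..y, φ v) - φ x * (y - x) - c / 2 * (y - x) ^ 2| ≤ ε * (y - x) ^ 2 := by
  have hε : 0 ≤ ε := (abs_nonneg _).trans (hb x hx)
  have hsub : Set.uIcc x y ⊆ K := hK.ordConnected.uIcc_subset hx hy
  have hint : IntervalIntegrable φ MeasureTheory.volume x y :=
    ContinuousOn.intervalIntegrable fun z hz => ((hd z (hsub hz)).continuousWithinAt).mono hsub
  have hlin : (∫ v in x..y, (φ x + c * (v - x))) = φ x * (y - x) + c / 2 * (y - x) ^ 2 := by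
    rw [intervalIntegral.integral_add (by simp) (by apply Continuous.intervalIntegrable; fun_prop),
      intervalIntegral.integral_const_mul,
      intervalIntegral.integral_sub (by simp) (by simp)]
    simp only [intervalIntegral.integral_const, integral_id, smul_eq_mul]
    ring
  have hrem : (∫ v in x..y, φ v) - φ x * (y - x) - c / 2 * (y - x) ^ 2 =
      ∫ v in x..y, (φ v - (φ x + c * (v - x))) := by
    rw [intervalIntegral.integral_sub hint (by apply Continuous.intervalIntegrable; fun_prop),
      hlin]
    ring
  have hbound : ∀ v ∈ Set.uIoc x y, ‖φ v - (φ x + c * (v - x))‖ ≤ ε * |y - x| := by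
    intro v hv
    have hv' := Set.uIoc_subset_uIcc hv
    have h := abs_sub_sub_mul_le_of_abs_deriv_sub_le hK hd hb hx (hsub hv')
    rw [Real.norm_eq_abs, ← sub_sub]
    exact h.trans (mul_le_mul_of_nonneg_left (Set.abs_sub_left_of_mem_uIcc hv') hε)
  have h := intervalIntegral.norm_integral_le_of_norm_le_const hbound
  rwa [← hrem, Real.norm_eq_abs, mul_assoc, abs_mul_abs_self, ← sq] at h


/-- If `φ` is continuous and nondecreasing on `[0,1]` and continuously
differentiable near `t₀ ∈ (0,1]` with derivative `d`, `tₙ → t₀` with `tₙ ∈ (0,1]`, and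
`Ψₙ(s) = n^{2/3}[Φ(tₙ + n^{-1/3}s) - Φ(tₙ) - φ(tₙ) n^{-1/3} s]` with `Φ(t) = ∫₀ᵗ φ`,
then `sup_{s ∈ [a,b] ∩ Iₙ} |Ψₙ(s) - (1/2)φ′(t₀)s²| → 0` for every compact `[a,b]`. -/
theorem Psi_n_uniform_limit
    (φ : ℝ → ℝ) (hφc : ContinuousOn φ (Set.Icc 0 1))
    (hφm : MonotoneOn φ (Set.Icc 0 1))
    (t₀ : ℝ) (ht₀ : t₀ ∈ Set.Ioc (0 : ℝ) 1)
    (δ : ℝ) (hδ : 0 < δ) (d : ℝ → ℝ)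
    (hd : ∀ x ∈ Set.Icc (0 : ℝ) 1 ∩ Set.Icc (t₀ - δ) (t₀ + δ),
      HasDerivWithinAt φ (d x) (Set.Icc 0 1) x)
    (hdcont : ContinuousOn d (Set.Icc (0 : ℝ) 1 ∩ Set.Icc (t₀ - δ) (t₀ + δ)))
    (t : ℕ → ℝ) (ht : ∀ n, t n ∈ Set.Ioc (0 : ℝ) 1)
    (htlim : Filter.Tendsto t Filter.atTop (nhds t₀))
    (Φ : ℝ → ℝ) (hΦ : ∀ u, Φ u = ∫ v in (0 : ℝ)..u, φ v)
    (Ψ : ℕ → ℝ → ℝ)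
    (hΨ : ∀ n s, Ψ n s = (n : ℝ) ^ ((2 : ℝ) / 3) *
      (Φ (t n + (n : ℝ) ^ (-(1 : ℝ) / 3) * s) - Φ (t n) -
        φ (t n) * ((n : ℝ) ^ (-(1 : ℝ) / 3) * s))) :
    ∀ a b : ℝ, a ≤ b → ∀ ε : ℝ, 0 < ε → ∃ N : ℕ, ∀ n ≥ N,
      ∀ s ∈ Set.Icc a b ∩ Set.Icc (-(n : ℝ) ^ ((1 : ℝ) / 3) * t n)
          ((n : ℝ) ^ ((1 : ℝ) / 3) * (1 - t n)),
        |Ψ n s - 1 / 2 * d t₀ * s ^ 2| ≤ ε := by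
  intro a b _ ε hε
  set M : ℝ := max |a| |b| + 1 with hM
  have hMpos : 0 < M := by positivity
  have ht₀K : t₀ ∈ Set.Icc (0 : ℝ) 1 ∩ Set.Icc (t₀ - δ) (t₀ + δ) :=
    ⟨⟨ht₀.1.le, ht₀.2⟩, by linarith, by linarith⟩
  obtain ⟨η, hη, hηd⟩ := Metric.continuousOn_iff.1 hdcont t₀ ht₀K (ε / M ^ 2) (by positivity)
  set r : ℝ := min δ (η / 2)
  have hrpos : 0 < r := by positivity
  have hrδ : r ≤ δ := min_le_left _ _
  have hrη : r < η := (min_le_right _ _).trans_lt (by linarith)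
  set K : Set ℝ := Set.Icc (0 : ℝ) 1 ∩ Set.Icc (t₀ - r) (t₀ + r)
  have hK : Convex ℝ K := (convex_Icc _ _).inter (convex_Icc _ _)
  have hKsub : K ⊆ Set.Icc (0 : ℝ) 1 ∩ Set.Icc (t₀ - δ) (t₀ + δ) := fun z hz =>
    ⟨hz.1, by linarith [hz.2.1], by linarith [hz.2.2]⟩
  have hdK : ∀ z ∈ K, HasDerivWithinAt φ (d z) K z := fun z hz =>
    (hd z (hKsub hz)).mono Set.inter_subset_left
  have hbK : ∀ z ∈ K, |d z - d t₀| ≤ ε / M ^ 2 := fun z hz => by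
    refine (hηd z (hKsub hz) ?_).le
    rw [Real.dist_eq, abs_lt]
    constructor <;> linarith [hz.2.1, hz.2.2]
  have hscale : Filter.Tendsto (fun n : ℕ => (n : ℝ) ^ (-(1 : ℝ) / 3) * M) Filter.atTop
      (nhds 0) := by
    have h := ((tendsto_rpow_neg_atTop (show (0 : ℝ) < 1 / 3 by norm_num)).comp
      tendsto_natCast_atTop_atTop).mul_const M
    simpa [Function.comp_def, neg_div] using h
  have hev := (hscale.eventually (gt_mem_nhds (half_pos hrpos))).and
    ((Metric.tendsto_nhds.1 htlim (r / 2) (half_pos hrpos)).and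
      (Filter.eventually_ge_atTop 1))
  obtain ⟨N, hN⟩ := Filter.eventually_atTop.1 hev
  refine ⟨N, fun n hn s hs => ?_⟩
  obtain ⟨hn₁, hn₂, hn₃⟩ := hN n hn
  have hnpos : (0 : ℝ) < n := by exact_mod_cast hn₃
  set h : ℝ := (n : ℝ) ^ (-(1 : ℝ) / 3) with hh
  have hhpos : 0 < h := Real.rpow_pos_of_pos hnpos _
  have hinv : h * (n : ℝ) ^ ((1 : ℝ) / 3) = 1 := by
    rw [hh, ← Real.rpow_add hnpos]
    norm_num
  have hsq : (n : ℝ) ^ ((2 : ℝ) / 3) * h ^ 2 = 1 := by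
    rw [hh, ← Real.rpow_natCast, ← Real.rpow_mul hnpos.le, ← Real.rpow_add hnpos]
    norm_num
  have hsM : |s| ≤ M := (abs_le_max_abs_abs hs.1.1 hs.1.2).trans (by linarith)
  have hhs : |h * s| < r / 2 := by
    rw [abs_mul, abs_of_pos hhpos]
    exact (mul_le_mul_of_nonneg_left hsM hhpos.le).trans_lt hn₁
  rw [Real.dist_eq] at hn₂
  obtain ⟨hhs₁, hhs₂⟩ := abs_lt.1 hhs
  obtain ⟨htn₁, htn₂⟩ := abs_lt.1 hn₂
  have hlow : 0 ≤ t n + h * s := by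
    have := mul_le_mul_of_nonneg_left hs.2.1 hhpos.le
    linear_combination this + t n * hinv
  have hup : t n + h * s ≤ 1 := by
    have := mul_le_mul_of_nonneg_left hs.2.2 hhpos.le
    linear_combination this + (1 - t n) * hinv
  have hx : t n ∈ K := ⟨⟨(ht n).1.le, (ht n).2⟩, by linarith, by linarith⟩
  have hy : t n + h * s ∈ K := ⟨⟨hlow, hup⟩, by linarith, by linarith⟩
  have hint : ∀ u ∈ Set.Icc (0 : ℝ) 1, IntervalIntegrable φ MeasureTheory.volume 0 u :=
    fun u hu => (hφc.mono (by
      rw [Set.uIcc_of_le hu.1]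
      exact Set.Icc_subset_Icc_right hu.2)).intervalIntegrable
  have hmain := abs_integral_sub_quadratic_le hK hdK hbK hx hy
  rw [← intervalIntegral.integral_interval_sub_left (hint _ hy.1) (hint _ hx.1), ← hΦ, ← hΦ,
    add_sub_cancel_left] at hmain
  have hn23 : 0 < (n : ℝ) ^ ((2 : ℝ) / 3) := Real.rpow_pos_of_pos hnpos _
  have hΨeq : Ψ n s - 1 / 2 * d t₀ * s ^ 2 = (n : ℝ) ^ ((2 : ℝ) / 3) *
      (Φ (t n + h * s) - Φ (t n) - φ (t n) * (h * s) - d t₀ / 2 * (h * s) ^ 2) := by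
    rw [hΨ]
    linear_combination (d t₀ / 2 * s ^ 2) * hsq
  have hs2 : s ^ 2 ≤ M ^ 2 := sq_le_sq' (abs_le.1 hsM).1 (abs_le.1 hsM).2
  rw [hΨeq, abs_mul, abs_of_pos hn23]
  calc _ ≤ (n : ℝ) ^ ((2 : ℝ) / 3) * (ε / M ^ 2 * (h * s) ^ 2) :=
        mul_le_mul_of_nonneg_left hmain hn23.le
    _ = ε / M ^ 2 * s ^ 2 := by linear_combination (ε / M ^ 2 * s ^ 2) * hsq
    _ ≤ ε / M ^ 2 * M ^ 2 := by gcongr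
    _ = ε := by field_simp
end

section
/- Let φ : [0,1] → ℝ be nondecreasing, let t ∈ (0,1], γ > 0, and δ ∈ (0,1), and suppose φ is differentiable at every point of [t − δ, t + δ] ∩ [0,1] with (9/5) γ ≤ φ′ ≤ (11/5) γ there. Let Φ(u) = ∫₀^u φ(v) dv, let n be an integer with n > δ^{−3}, and for s ∈ I = [−n^{1/3} t, n^{1/3}(1 − t)] define Ψ(s) = n^{2/3} [ Φ(t + n^{−1/3} s) − Φ(t) − φ(t) n^{−1/3} s ]. Then (9/10) γ s² ≤ Ψ(s) ≤ (11/10) γ s² for all s ∈ I with |s| ≤ δ n^{1/3}, and Ψ(s) ≥ (9/10) γ · min(s², |s|) for all s ∈ I. -/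
/-- Two-sided quadratic bounds for the primitive of a monotone function squeezed between
two lines on `[0, δ]`. -/
theorem integral_quadratic_bounds_of_linear_bounds {g : ℝ → ℝ} {L δ c C : ℝ}
    (hg : MonotoneOn g (Set.Icc 0 L))
    (hlin : ∀ u ∈ Set.Icc 0 L, u ≤ δ → c * u ≤ g u ∧ g u ≤ C * u)
    {h : ℝ} (h0 : 0 ≤ h) (hL : h ≤ L) (hδ : h ≤ δ) :
    c / 2 * h ^ 2 ≤ ∫ u in (0 : ℝ)..h, g u ∧ ∫ u in (0 : ℝ)..h, g u ≤ C / 2 * h ^ 2 := by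
  have hint : IntervalIntegrable g MeasureTheory.volume 0 h := by
    apply MonotoneOn.intervalIntegrable
    rw [Set.uIcc_of_le h0]
    exact hg.mono (Set.Icc_subset_Icc_right hL)
  have hline (k : ℝ) : ∫ u in (0 : ℝ)..h, k * u = k / 2 * h ^ 2 := by
    rw [intervalIntegral.integral_const_mul, integral_id]
    ring
  have hk (k : ℝ) : IntervalIntegrable (fun u : ℝ => k * u) MeasureTheory.volume 0 h :=
    (continuous_const.mul continuous_id).intervalIntegrable 0 h
  constructor
  · rw [← hline c]
    exact intervalIntegral.integral_mono_on h0 (hk c) hint fun u hu =>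
      (hlin u ⟨hu.1, hu.2.trans hL⟩ (hu.2.trans hδ)).1
  · rw [← hline C]
    exact intervalIntegral.integral_mono_on h0 hint (hk C) fun u hu =>
      (hlin u ⟨hu.1, hu.2.trans hL⟩ (hu.2.trans hδ)).2

/-- Beyond `δ`, the primitive of a monotone function bounded below by a line on `[0, δ]`
grows at least linearly. -/
theorem linear_le_integral_of_linear_bounds {g : ℝ → ℝ} {L δ c C : ℝ}
    (hg : MonotoneOn g (Set.Icc 0 L))
    (hlin : ∀ u ∈ Set.Icc 0 L, u ≤ δ → c * u ≤ g u ∧ g u ≤ C * u)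
    (hc : 0 ≤ c) (h0 : 0 ≤ δ) {h : ℝ} (hL : h ≤ L) (hδ : δ ≤ h) :
    c / 2 * δ * h ≤ ∫ u in (0 : ℝ)..h, g u := by
  have hint {a b : ℝ} (ha : 0 ≤ a) (hab : a ≤ b) (hb : b ≤ L) :
      IntervalIntegrable g MeasureTheory.volume a b := by
    apply MonotoneOn.intervalIntegrable
    rw [Set.uIcc_of_le hab]
    exact hg.mono (Set.Icc_subset_Icc ha hb)
  have hnear :=
    (integral_quadratic_bounds_of_linear_bounds hg hlin h0 (hδ.trans hL) le_rfl).1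
  have hfar : ∫ _ in δ..h, c * δ ≤ ∫ u in δ..h, g u := by
    refine intervalIntegral.integral_mono_on hδ intervalIntegrable_const
      (hint h0 hδ hL) fun u hu => ?_
    have hδL : δ ∈ Set.Icc 0 L := ⟨h0, hδ.trans hL⟩
    exact (hlin δ hδL le_rfl).1.trans (hg hδL ⟨h0.trans hu.1, hu.2.trans hL⟩ hu.1)
  rw [intervalIntegral.integral_const, smul_eq_mul] at hfar
  rw [← intervalIntegral.integral_add_adjacent_intervals (hint le_rfl h0 (hδ.trans hL))
    (hint h0 hδ hL)]
  nlinarith [mul_nonneg (mul_nonneg hc h0) (sub_nonneg.2 hδ)]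

/-- Derivative bounds at the points of `[0,1]` close to `t` bound the increments of `φ`. -/
theorem increment_bounds_of_hasDerivWithinAt {φ d : ℝ → ℝ} {t δ c C : ℝ}
    (hd : ∀ u ∈ Set.Icc (t - δ) (t + δ) ∩ Set.Icc (0 : ℝ) 1,
      HasDerivWithinAt φ (d u) (Set.Icc 0 1) u ∧ c ≤ d u ∧ d u ≤ C)
    {x y : ℝ} (hx : x ∈ Set.Icc (t - δ) (t + δ) ∩ Set.Icc (0 : ℝ) 1)
    (hy : y ∈ Set.Icc (t - δ) (t + δ) ∩ Set.Icc (0 : ℝ) 1) (hxy : x ≤ y) :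
    c * (y - x) ≤ φ y - φ x ∧ φ y - φ x ≤ C * (y - x) := by
  set D := Set.Icc (t - δ) (t + δ) ∩ Set.Icc (0 : ℝ) 1 with hD
  have hconv : Convex ℝ D := (convex_Icc _ _).inter (convex_Icc _ _)
  have hcont : ContinuousOn φ D := fun u hu =>
    (hd u hu).1.continuousWithinAt.mono Set.inter_subset_right
  have hder : ∀ u ∈ interior D, HasDerivAt φ (d u) u := fun u hu =>
    (hd u (interior_subset hu)).1.hasDerivAt
      (mem_interior_iff_mem_nhds.1 (interior_mono Set.inter_subset_right hu))
  have hdiff : DifferentiableOn ℝ φ (interior D) := fun u hu =>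
    (hder u hu).differentiableAt.differentiableWithinAt
  constructor
  · refine hconv.mul_sub_le_image_sub_of_le_deriv hcont hdiff (fun u hu => ?_) x hx y hy hxy
    rw [(hder u hu).deriv]
    exact (hd u (interior_subset hu)).2.1
  · refine hconv.image_sub_le_mul_sub_of_deriv_le hcont hdiff (fun u hu => ?_) x hx y hy hxy
    rw [(hder u hu).deriv]
    exact (hd u (interior_subset hu)).2.2

/-- The remainder of the first-order expansion at `t` of the primitive of a monotone function:
quadratic bounds near `t` and a linear lower bound away from `t`. -/
theorem integral_sub_const_bounds {φ d : ℝ → ℝ} {t δ c C : ℝ}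
    (hφ : MonotoneOn φ (Set.Icc 0 1)) (ht : t ∈ Set.Icc (0 : ℝ) 1) (hc : 0 ≤ c) (hδ : 0 ≤ δ)
    (hd : ∀ u ∈ Set.Icc (t - δ) (t + δ) ∩ Set.Icc (0 : ℝ) 1,
      HasDerivWithinAt φ (d u) (Set.Icc 0 1) u ∧ c ≤ d u ∧ d u ≤ C)
    {h : ℝ} (hh : t + h ∈ Set.Icc (0 : ℝ) 1) :
    (|h| ≤ δ → c / 2 * h ^ 2 ≤ ∫ v in t..t + h, (φ v - φ t) ∧
      ∫ v in t..t + h, (φ v - φ t) ≤ C / 2 * h ^ 2) ∧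
    (δ ≤ |h| → c / 2 * δ * |h| ≤ ∫ v in t..t + h, (φ v - φ t)) := by
  obtain ⟨ht0, ht1⟩ := ht
  obtain ⟨hh0, hh1⟩ := hh
  have htD : t ∈ Set.Icc (t - δ) (t + δ) ∩ Set.Icc (0 : ℝ) 1 :=
    ⟨⟨by linarith, by linarith⟩, ht0, ht1⟩
  rcases le_total 0 h with h0 | h0
  · have hmono : MonotoneOn (fun u => φ (t + u) - φ t) (Set.Icc 0 (1 - t)) := by
      intro a ha b hb hab
      have := hφ (a := t + a) (b := t + b) ⟨by linarith [ha.1], by linarith [ha.2]⟩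
        ⟨by linarith [hb.1], by linarith [hb.2]⟩ (by linarith)
      simpa using this
    have hlin : ∀ u ∈ Set.Icc 0 (1 - t), u ≤ δ →
        c * u ≤ φ (t + u) - φ t ∧ φ (t + u) - φ t ≤ C * u := by
      intro u hu huδ
      have := increment_bounds_of_hasDerivWithinAt hd htD (y := t + u)
        ⟨⟨by linarith [hu.1], by linarith⟩, by linarith [hu.1], by linarith [hu.2]⟩
        (by linarith [hu.1])
      simpa using this
    have hF : ∫ v in t..t + h, (φ v - φ t) = ∫ u in (0 : ℝ)..h, (φ (t + u) - φ t) := by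
      rw [intervalIntegral.integral_comp_add_left (fun v => φ v - φ t), add_zero]
    rw [hF, abs_of_nonneg h0]
    exact ⟨integral_quadratic_bounds_of_linear_bounds hmono hlin h0 (by linarith),
      linear_le_integral_of_linear_bounds hmono hlin hc hδ (by linarith)⟩
  · have hmono : MonotoneOn (fun u => φ t - φ (t - u)) (Set.Icc 0 t) := by
      intro a ha b hb hab
      have := hφ (a := t - b) (b := t - a) ⟨by linarith [hb.2], by linarith [hb.1]⟩
        ⟨by linarith [ha.2], by linarith [ha.1]⟩ (by linarith)
      exact sub_le_sub_left this _
    have hlin : ∀ u ∈ Set.Icc 0 t, u ≤ δ →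
        c * u ≤ φ t - φ (t - u) ∧ φ t - φ (t - u) ≤ C * u := by
      intro u hu huδ
      have := increment_bounds_of_hasDerivWithinAt hd (x := t - u)
        ⟨⟨by linarith, by linarith [hu.1]⟩, by linarith [hu.2], by linarith [hu.1]⟩ htD
        (by linarith [hu.1])
      simpa using this
    have hF : ∫ v in t..t + h, (φ v - φ t) = ∫ u in (0 : ℝ)..-h, (φ t - φ (t - u)) := by
      rw [intervalIntegral.integral_comp_sub_left (fun v => φ t - φ v), sub_zero, sub_neg_eq_add,
        intervalIntegral.integral_symm, ← intervalIntegral.integral_neg]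
      simp
    rw [hF, abs_of_nonpos h0, ← neg_sq h]
    exact ⟨integral_quadratic_bounds_of_linear_bounds hmono hlin (by linarith) (by linarith),
      linear_le_integral_of_linear_bounds hmono hlin hc hδ (by linarith)⟩

/-- If `φ` is nondecreasing on `[0,1]` and differentiable on
`[t-δ, t+δ] ∩ [0,1]` with `(9/5)γ ≤ φ′ ≤ (11/5)γ` there, `n > δ⁻³`, and
`Ψ(s) = n^{2/3}[Φ(t + n^{-1/3}s) - Φ(t) - φ(t) n^{-1/3}s]` with `Φ(u) = ∫₀ᵘ φ`, then
`(9/10)γ s² ≤ Ψ(s) ≤ (11/10)γ s²` on `I ∩ {|s| ≤ δ n^{1/3}}` and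
`Ψ(s) ≥ (9/10)γ min(s², |s|)` on all of `I = [-n^{1/3}t, n^{1/3}(1-t)]`. -/
theorem Psi_quadratic_bounds
    (φ : ℝ → ℝ) (hφm : MonotoneOn φ (Set.Icc 0 1))
    (t : ℝ) (ht : t ∈ Set.Ioc (0 : ℝ) 1)
    (γ : ℝ) (hγ : 0 < γ) (δ : ℝ) (hδ : δ ∈ Set.Ioo (0 : ℝ) 1)
    (d : ℝ → ℝ)
    (hd : ∀ u ∈ Set.Icc (t - δ) (t + δ) ∩ Set.Icc (0 : ℝ) 1,
      HasDerivWithinAt φ (d u) (Set.Icc 0 1) u ∧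
        9 / 5 * γ ≤ d u ∧ d u ≤ 11 / 5 * γ)
    (Φ : ℝ → ℝ) (hΦ : ∀ u, Φ u = ∫ v in (0 : ℝ)..u, φ v)
    (n : ℕ) (hn : δ⁻¹ ^ 3 < (n : ℝ))
    (Ψ : ℝ → ℝ)
    (hΨ : ∀ s, Ψ s = (n : ℝ) ^ ((2 : ℝ) / 3) *
      (Φ (t + (n : ℝ) ^ (-(1 : ℝ) / 3) * s) - Φ t -
        φ t * ((n : ℝ) ^ (-(1 : ℝ) / 3) * s))) :
    (∀ s ∈ Set.Icc (-(n : ℝ) ^ ((1 : ℝ) / 3) * t) ((n : ℝ) ^ ((1 : ℝ) / 3) * (1 - t)),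
      |s| ≤ δ * (n : ℝ) ^ ((1 : ℝ) / 3) →
        9 / 10 * γ * s ^ 2 ≤ Ψ s ∧ Ψ s ≤ 11 / 10 * γ * s ^ 2) ∧
    (∀ s ∈ Set.Icc (-(n : ℝ) ^ ((1 : ℝ) / 3) * t) ((n : ℝ) ^ ((1 : ℝ) / 3) * (1 - t)),
      9 / 10 * γ * min (s ^ 2) |s| ≤ Ψ s) := by
  obtain ⟨ht0, ht1⟩ := ht
  obtain ⟨hδ0, hδ1⟩ := hδ
  have hn0 : (0 : ℝ) < n := lt_trans (by positivity) hn
  set a : ℝ := (n : ℝ) ^ ((1 : ℝ) / 3) with ha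
  have ha0 : 0 < a := Real.rpow_pos_of_pos hn0 _
  have ha3 : a ^ 3 = n := by
    rw [ha, ← Real.rpow_natCast, ← Real.rpow_mul hn0.le]
    norm_num
  have ha2 : (n : ℝ) ^ ((2 : ℝ) / 3) = a ^ 2 := by
    rw [ha, ← Real.rpow_natCast, ← Real.rpow_mul hn0.le]
    norm_num
  have hainv : (n : ℝ) ^ (-(1 : ℝ) / 3) = a⁻¹ := by
    rw [ha, ← Real.rpow_neg hn0.le, neg_div]
  have haδ : 1 ≤ a * δ := by
    have hlt : δ⁻¹ < a := lt_of_pow_lt_pow_left₀ 3 ha0.le (ha3 ▸ hn)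
    have := mul_le_mul_of_nonneg_right hlt.le hδ0.le
    rwa [inv_mul_cancel₀ hδ0.ne'] at this
  have hmem {h : ℝ} (hs : a * h ∈ Set.Icc (-a * t) (a * (1 - t))) :
      t + h ∈ Set.Icc (0 : ℝ) 1 := by
    have h1 : a * -t ≤ a * h := by linarith [hs.1]
    have h2 := le_of_mul_le_mul_left h1 ha0
    have h3 := le_of_mul_le_mul_left hs.2 ha0
    exact ⟨by linarith, by linarith⟩
  have hint {x y : ℝ} (hx : x ∈ Set.Icc (0 : ℝ) 1) (hy : y ∈ Set.Icc (0 : ℝ) 1) :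
      IntervalIntegrable φ MeasureTheory.volume x y :=
    (hφm.mono (Set.uIcc_subset_Icc hx hy)).intervalIntegrable
  have hΨint {h : ℝ} (hh : t + h ∈ Set.Icc (0 : ℝ) 1) :
      Ψ (a * h) = a ^ 2 * ∫ v in t..t + h, (φ v - φ t) := by
    have h0 : (0 : ℝ) ∈ Set.Icc (0 : ℝ) 1 := by simp
    have htI : t ∈ Set.Icc (0 : ℝ) 1 := ⟨ht0.le, ht1⟩
    rw [hΨ, ha2, hainv, inv_mul_cancel_left₀ ha0.ne', hΦ, hΦ,
      intervalIntegral.integral_interval_sub_left (hint h0 hh) (hint h0 htI),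
      intervalIntegral.integral_sub (hint htI hh) intervalIntegrable_const,
      intervalIntegral.integral_const, smul_eq_mul]
    ring
  have hbounds {h : ℝ} (hh : t + h ∈ Set.Icc (0 : ℝ) 1) :=
    integral_sub_const_bounds hφm ⟨ht0.le, ht1⟩ (by positivity) hδ0.le hd hh
  have hquad : ∀ s ∈ Set.Icc (-a * t) (a * (1 - t)), |s| ≤ δ * a →
      9 / 10 * γ * s ^ 2 ≤ Ψ s ∧ Ψ s ≤ 11 / 10 * γ * s ^ 2 := by
    intro s hs hsδ
    obtain ⟨h, rfl⟩ : ∃ h, s = a * h := ⟨a⁻¹ * s, (mul_inv_cancel_left₀ ha0.ne' s).symm⟩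
    rw [abs_mul, abs_of_pos ha0, mul_comm δ] at hsδ
    obtain ⟨hl, hu⟩ := (hbounds (hmem hs)).1 (le_of_mul_le_mul_left hsδ ha0)
    rw [hΨint (hmem hs)]
    have hl' := mul_le_mul_of_nonneg_left hl (sq_nonneg a)
    have hu' := mul_le_mul_of_nonneg_left hu (sq_nonneg a)
    constructor <;> linarith
  refine ⟨hquad, fun s hs => ?_⟩
  rcases le_total |s| (δ * a) with hsδ | hsδ
  · exact (mul_le_mul_of_nonneg_left (min_le_left _ _) (by positivity)).trans (hquad s hs hsδ).1
  · obtain ⟨h, rfl⟩ : ∃ h, s = a * h := ⟨a⁻¹ * s, (mul_inv_cancel_left₀ ha0.ne' s).symm⟩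
    refine (mul_le_mul_of_nonneg_left (min_le_right _ _) (by positivity)).trans ?_
    rw [abs_mul, abs_of_pos ha0, mul_comm δ] at hsδ
    have hl := (hbounds (hmem hs)).2 (le_of_mul_le_mul_left hsδ ha0)
    rw [hΨint (hmem hs), abs_mul, abs_of_pos ha0]
    have hl' := mul_le_mul_of_nonneg_left hl (sq_nonneg a)
    have hscale : 9 / 10 * γ * (a * |h|) * 1 ≤ 9 / 10 * γ * (a * |h|) * (a * δ) :=
      mul_le_mul_of_nonneg_left haδ (by positivity)
    linarith
end
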